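/- arXiv:2509.22610 — 6 statements merged into one kernel-verified Lean document; each statement's English description precedes it below -/
import Mathlib

section
/- For all integers m and n, in the field ℚ(v)((x)) of formal Laurent series in x over ℚ(v), the product of the expansions at x = 0 satisfies σ_m⁰ · σ_n⁰ = Σ_{i=0}^∞ γ_{m,n}^i · σ⁰_{m+n−i}, where γ_{m,n}^i = {m}_i·{n}_i·binom[m+n+1, i]. The right-hand sum is well defined: for each fixed exponent l ∈ ℤ only finitely many indices i contribute a nonzero coefficient of x^l (σ⁰_{m+n−i} lies in x^{i−m−n}·ℚ(v)[[x]] once i > m+n), so the identity means that for every l ∈ ℤ the coefficient of x^l in σ_m⁰σ_n⁰ equals the finite sum Σ_i γ_{m,n}^i · (coefficient of x^l in σ⁰_{m+n−i}). -/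
/-!
STATEMENT 0: For all integers m and n, in the field ℚ(v)((x)) of formal Laurent
series in x over ℚ(v), the product of the expansions at x = 0 satisfies
σ_m⁰ · σ_n⁰ = Σ_{i=0}^∞ γ_{m,n}^i · σ⁰_{m+n−i}, where
γ_{m,n}^i = {m}_i·{n}_i·binom[m+n+1, i].  The identity is stated coefficientwise:
for every l ∈ ℤ only finitely many indices i contribute a nonzero coefficient of
x^l, and the coefficient of x^l in σ_m⁰σ_n⁰ equals the finite sum
Σ_i γ_{m,n}^i · (coefficient of x^l in σ⁰_{m+n−i}).
-/

noncomputable section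

/-- The variable `v` of the field `ℚ(v)`. -/
def V : RatFunc ℚ := RatFunc.X

/-- `{n} = vⁿ − v⁻ⁿ`. -/
def sm (n : ℤ) : RatFunc ℚ := V ^ n - V ^ (-n)

/-- `{n}_k = {n}{n−1}⋯{n−k+1}`. -/
def smP (n : ℤ) (k : ℕ) : RatFunc ℚ := ∏ i ∈ Finset.range k, sm (n - i)

/-- The balanced Gaussian binomial `binom[n,k] = {n}_k/{k}_k`. -/
def bbinom (n : ℤ) (k : ℕ) : RatFunc ℚ := smP n k / smP k k

/-- `γ_{m,n}^i = {m}_i·{n}_i·binom[m+n+1, i]`. -/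
def γ (m n : ℤ) (i : ℕ) : RatFunc ℚ := smP m i * smP n i * bbinom (m + n + 1) i

/-- The Laurent series variable `x` in `ℚ(v)((x))`. -/
def xx : LaurentSeries (RatFunc ℚ) := HahnSeries.single 1 1

/-- The factor `x + x⁻¹ − qⁱ − q⁻ⁱ` (with `q = v²`), as an element of `ℚ(v)((x))`. -/
def fac (i : ℕ) : LaurentSeries (RatFunc ℚ) :=
  xx + xx⁻¹ - HahnSeries.C (V ^ (2 * (i : ℤ))) - HahnSeries.C (V ^ (-(2 * (i : ℤ))))

/-- `σ_n⁰`, the expansion at `x = 0` of the rational function `σ_n`: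
for `n ≥ 0` it is `∏_{i=1}^{n}(x+x⁻¹−qⁱ−q⁻ⁱ)`, and for `n = −k−1 < 0` it is the
inverse (in the Laurent series field, i.e. the Taylor expansion at `x = 0`) of
`∏_{i=0}^{k}(x+x⁻¹−qⁱ−q⁻ⁱ)`. -/
def σ0 (n : ℤ) : LaurentSeries (RatFunc ℚ) :=
  if 0 ≤ n then ∏ i ∈ Finset.range n.toNat, fac (i + 1)
  else (∏ i ∈ Finset.range (-n).toNat, fac i)⁻¹

def facZ (j : ℤ) : LaurentSeries (RatFunc ℚ) :=
  xx + xx⁻¹ - HahnSeries.C (V ^ (2 * j)) - HahnSeries.C (V ^ (-(2 * j)))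

lemma V_ne : V ≠ 0 := RatFunc.X_ne_zero

lemma sm_ne (j : ℕ) (hj : 0 < j) : sm j ≠ 0 := by
  intro h
  unfold sm at h
  have h1 : V ^ (2 * j) = 1 := by
    have h2 : V ^ (j : ℤ) * V ^ (-(j : ℤ)) = 1 := by
      rw [← zpow_add₀ V_ne]; simp
    rw [sub_eq_zero] at h
    rw [← h, zpow_natCast] at h2
    rw [two_mul, pow_add]; exact h2
  unfold V at h1
  rw [← RatFunc.algebraMap_X, ← map_pow, ← map_one (algebraMap (Polynomial ℚ) (RatFunc ℚ))] at h1
  have h3 := RatFunc.algebraMap_injective ℚ h1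
  have h4 := congrArg Polynomial.natDegree h3
  simp at h4
  omega

lemma smP_ne (k : ℕ) : smP k k ≠ 0 := by
  unfold smP
  rw [Finset.prod_ne_zero_iff]
  intro i hi
  have hi := Finset.mem_range.mp hi
  have : ((k : ℤ) - i) = ((k - i : ℕ) : ℤ) := by omega
  rw [this]
  exact sm_ne _ (by omega)

lemma facZ_nat (i : ℕ) : facZ i = fac i := rfl

lemma facZ_neg (j : ℤ) : facZ (-j) = facZ j := by
  unfold facZ
  rw [show 2 * -j = -(2*j) by ring, neg_neg]; ring

lemma xx_inv : xx⁻¹ = HahnSeries.single (-1) (1 : RatFunc ℚ) := by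
  unfold xx; rw [HahnSeries.inv_single]; simp

lemma coeff_facZ_mul (j : ℤ) (f : LaurentSeries (RatFunc ℚ)) (l : ℤ) :
    (facZ j * f).coeff l = f.coeff (l-1) + f.coeff (l+1)
      - (V ^ (2 * j) + V ^ (-(2 * j))) * f.coeff l := by
  have e1 : (xx * f).coeff l = f.coeff (l-1) := by
    have := HahnSeries.coeff_single_mul_add (r := (1 : RatFunc ℚ)) (x := f) (a := l-1) (b := 1)
    simpa [xx] using this
  have e2 : (xx⁻¹ * f).coeff l = f.coeff (l+1) := by
    have := HahnSeries.coeff_single_mul_add (r := (1 : RatFunc ℚ)) (x := f) (a := l+1) (b := -1)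
    rw [xx_inv]
    simpa using this
  unfold facZ
  rw [sub_mul, sub_mul, add_mul, HahnSeries.coeff_sub, HahnSeries.coeff_sub, HahnSeries.coeff_add,
    e1, e2, HahnSeries.C_mul_eq_smul, HahnSeries.C_mul_eq_smul, HahnSeries.coeff_smul,
    HahnSeries.coeff_smul, smul_eq_mul, smul_eq_mul]
  ring

lemma coeff_facZ (j : ℤ) (l : ℤ) (hl : l < 0) :
    (facZ j).coeff l = if l = -1 then 1 else 0 := by
  have := coeff_facZ_mul j 1 l
  rw [mul_one] at this
  rw [this]
  simp only [HahnSeries.coeff_one]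
  rw [if_neg (by omega), if_neg (by omega : ¬ l = 0)]
  by_cases h : l = -1
  · simp [h]
  · rw [if_neg (by omega), if_neg h]; ring

lemma facZ_ne (j : ℤ) : facZ j ≠ 0 := by
  intro h
  have := coeff_facZ j (-1) (by norm_num)
  rw [h] at this
  simp at this

lemma facZ_order (j : ℤ) : (facZ j).order = -1 := by
  apply le_antisymm
  · apply HahnSeries.order_le_of_coeff_ne_zero
    rw [coeff_facZ j _ (by norm_num)]; simp
  · by_contra h
    push Not at h
    have h1 := HahnSeries.coeff_order_eq_zero.not.mpr (facZ_ne j)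
    rw [coeff_facZ j _ (by omega), if_neg (by omega)] at h1
    exact h1 rfl

lemma sig_succ (k : ℤ) : σ0 (k+1) = facZ (k+1) * σ0 k := by
  unfold σ0
  rcases lt_or_ge k 0 with h | h
  · rw [if_neg (by omega : ¬ 0 ≤ k)]
    obtain ⟨a, rfl⟩ : ∃ a : ℕ, k = -(a : ℤ) - 1 := ⟨(-k-1).toNat, by omega⟩
    rw [show (-(-(a : ℤ) - 1)).toNat = a + 1 by omega, Finset.prod_range_succ,
      show -(a : ℤ) - 1 + 1 = -a by ring, facZ_neg, facZ_nat, mul_inv, mul_comm,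
      mul_assoc, inv_mul_cancel₀ (by rw [← facZ_nat]; exact facZ_ne _), mul_one]
    split_ifs with h0
    · have : a = 0 := by omega
      subst this; simp
    · simp
  · rw [if_pos h, if_pos (by omega)]
    obtain ⟨a, rfl⟩ : ∃ a : ℕ, k = a := ⟨k.toNat, by omega⟩
    rw [show ((a : ℤ) + 1).toNat = a + 1 by omega, Finset.prod_range_succ, mul_comm]
    rfl

lemma sig_zero : σ0 0 = 1 := by simp [σ0]

lemma sig_ord (k : ℤ) : σ0 k ≠ 0 ∧ (σ0 k).order = -k := by
  induction k using Int.induction_on with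
  | zero => rw [sig_zero]; simp
  | succ i ih =>
    rw [sig_succ]
    refine ⟨mul_ne_zero (facZ_ne _) ih.1, ?_⟩
    rw [HahnSeries.order_mul (facZ_ne _) ih.1, facZ_order, ih.2]; ring
  | pred i ih =>
    have h := sig_succ (-(i : ℤ) - 1)
    rw [sub_add_cancel] at h
    rw [h] at ih
    have h1 := right_ne_zero_of_mul ih.1
    refine ⟨h1, ?_⟩
    have h2 := ih.2
    rw [HahnSeries.order_mul (facZ_ne _) h1, facZ_order] at h2
    linarith

lemma sig_coeff (k l : ℤ) (h : l < -k) : (σ0 k).coeff l = 0 :=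
  HahnSeries.coeff_eq_zero_of_lt_order (by rw [(sig_ord k).2]; exact h)

lemma sm_mul (a b : ℤ) : sm a * sm b = V ^ (a+b) + V ^ (-(a+b)) - V ^ (a-b) - V ^ (b-a) := by
  unfold sm
  rw [sub_mul, mul_sub, mul_sub, ← zpow_add₀ V_ne, ← zpow_add₀ V_ne, ← zpow_add₀ V_ne,
    ← zpow_add₀ V_ne, show -a + -b = -(a+b) by ring, show a + -b = a - b by ring,
    show -a + b = b - a by ring]
  ring

lemma smP_succ (n : ℤ) (k : ℕ) : smP n (k+1) = smP n k * sm (n - k) := by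
  unfold smP; rw [Finset.prod_range_succ]

lemma smP_succ' (n : ℤ) (k : ℕ) : smP (n+1) (k+1) = sm (n+1) * smP n k := by
  unfold smP; rw [Finset.prod_range_succ', mul_comm]
  congr 1
  · simp
  · apply Finset.prod_congr rfl
    intro i _
    congr 1; push_cast; ring

lemma sm_ne' (j : ℕ) : sm ((j : ℤ) + 1) ≠ 0 := by
  have := sm_ne (j+1) (by omega)
  push_cast at this; exact this

lemma gam_zero (m n : ℤ) : γ m n 0 = 1 := by simp [γ, bbinom, smP]

lemma gam_succ (m n : ℤ) (i : ℕ) : γ (m+1) n (i+1) = γ m n (i+1) + γ m n i *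
    (V ^ (2 * (m+n-i+1)) + V ^ (-(2 * (m+n-i+1))) - (V ^ (2 * (m+1)) + V ^ (-(2 * (m+1))))) := by
  have hd : V ^ (2 * (m+n-i+1)) + V ^ (-(2 * (m+n-i+1))) - (V ^ (2 * (m+1)) + V ^ (-(2 * (m+1))))
      = sm (n - i) * sm (2*m+n-i+2) := by
    rw [sm_mul, show n - i + (2*m+n-i+2) = 2 * (m+n-i+1) by ring,
      show n - i - (2*m+n-i+2) = -(2 * (m+1)) by ring,
      show (2*m+n-i+2) - (n - i) = (2 * (m+1)) by ring]
    ring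
  have key : sm (m+1) * sm (m+n+1+1) = sm (m - i) * sm (m+n+1-i) + sm (i+1) * sm (2*m+n-i+2) := by
    rw [sm_mul, sm_mul, sm_mul]
    rw [show m + 1 + (m+n+1+1) = 2*m+n+3 by ring, show m + 1 - (m+n+1+1) = -(n+1) by ring,
      show m+n+1+1-(m+1) = n+1 by ring, show m - i + (m+n+1-i) = 2*m+n+1-2*i by ring,
      show m - i - (m+n+1-i) = -(n+1) by ring, show m+n+1-i - (m-i) = n+1 by ring,
      show (i:ℤ)+1+(2*m+n-i+2) = 2*m+n+3 by ring,
      show (i:ℤ)+1-(2*m+n-i+2) = -(2*m+n+1-2*i) by ring,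
      show (2*m+n-i+2) - ((i:ℤ)+1) = 2*m+n+1-2*i by ring]
    ring
  rw [hd]
  unfold γ bbinom
  rw [show m + 1 + n + 1 = (m+n+1)+1 by ring, smP_succ', smP_succ', smP_succ n, smP_succ m,
    smP_succ (m+n+1)]
  push_cast
  rw [smP_succ' i i]
  have h1 := smP_ne i
  have h2 := sm_ne' i
  field_simp
  linear_combination (smP m i * smP n i * sm (n - i) * smP (m+n+1) i) * key

lemma gam_base (n : ℤ) (i : ℕ) : γ 0 n (i+1) = 0 := by
  have : smP 0 (i+1) = 0 := by
    unfold smP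
    apply Finset.prod_eq_zero (i := 0) (by simp)
    simp [sm]
  simp [γ, this]

/-- partial sums -/
def Sp (m n : ℤ) (M : ℕ) (l : ℤ) : RatFunc ℚ :=
  ∑ i ∈ Finset.range M, γ m n i * (σ0 (m + n - i)).coeff l

lemma Sp_stable (m n l : ℤ) (M M' : ℕ) (h : l + m + n < M) (h' : M ≤ M') :
    Sp m n M' l = Sp m n M l := by
  unfold Sp
  symm
  apply Finset.sum_subset (Finset.range_mono h')
  intro i _ hi
  rw [Finset.mem_range] at hi
  rw [sig_coeff _ _ (by omega), mul_zero]

lemma Sp_eq (m n l : ℤ) (M M' : ℕ) (h : l + m + n < M) (h' : l + m + n < M') :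
    Sp m n M' l = Sp m n M l := by
  rcases le_total M M' with hh | hh
  · exact Sp_stable _ _ _ _ _ h hh
  · exact (Sp_stable _ _ _ _ _ h' hh).symm

def Rc (m n l : ℤ) : RatFunc ℚ := Sp m n (l + m + n + 1).toNat l

lemma Rc_eq (m n l : ℤ) (M : ℕ) (h : l + m + n < M) : Rc m n l = Sp m n M l :=
  Sp_eq _ _ _ _ _ h (by omega)

lemma Rc_zero (m n l : ℤ) (h : l < -(m+n)) : Rc m n l = 0 := by
  rw [Rc_eq m n l 0 (by push_cast; omega)]; simp [Sp]

lemma Rc_bdd (m n : ℤ) : BddBelow (Function.support (Rc m n)) :=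
  ⟨-(m+n), fun l hl => by
    by_contra h
    exact hl (Rc_zero m n l (by omega))⟩

def R (m n : ℤ) : LaurentSeries (RatFunc ℚ) := HahnSeries.ofSuppBddBelow (Rc m n) (Rc_bdd m n)

lemma R_coeff (m n l : ℤ) : (R m n).coeff l = Rc m n l := rfl

lemma R_succ (m n : ℤ) : R (m+1) n = facZ (m+1) * R m n := by
  ext l
  rw [coeff_facZ_mul]
  simp only [R_coeff]
  obtain ⟨M, hM⟩ : ∃ M : ℕ, l + m + n + 5 < M := ⟨(l+m+n+6).toNat, by omega⟩
  rw [Rc_eq m n (l-1) M (by omega), Rc_eq m n (l+1) M (by omega), Rc_eq m n l M (by omega),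
    Rc_eq (m+1) n l (M+1) (by push_cast; omega)]
  unfold Sp
  rw [Finset.mul_sum, ← Finset.sum_add_distrib, ← Finset.sum_sub_distrib, Finset.sum_range_succ']
  have hs : ∀ i : ℕ, (σ0 (m+1+n-i)).coeff l = (σ0 (m+n-i)).coeff (l-1) + (σ0 (m+n-i)).coeff (l+1)
      - (V ^ (2 * (m+n-i+1)) + V ^ (-(2 * (m+n-i+1)))) * (σ0 (m+n-i)).coeff l := by
    intro i
    rw [show m+1+n-i = (m+n-i)+1 by ring, sig_succ, coeff_facZ_mul]
  have hsum : ∑ i ∈ Finset.range M, γ m n (i+1) * (σ0 (m+1+n-(i+1 : ℕ))).coeff l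
      + γ m n 0 * (σ0 (m+1+n-(0:ℕ))).coeff l
      = ∑ i ∈ Finset.range M, γ m n i * (σ0 (m+1+n-i)).coeff l := by
    rw [← Finset.sum_range_succ' (fun i : ℕ => γ m n i * (σ0 (m+1+n-i)).coeff l),
      Finset.sum_range_succ, sig_coeff _ _ (by omega : l < -(m+1+n-M))]
    ring
  rw [gam_zero] at *
  simp only [gam_succ, add_mul, Finset.sum_add_distrib]
  rw [add_right_comm, hsum, ← Finset.sum_add_distrib]
  apply Finset.sum_congr rfl
  intro i _
  rw [hs, show m+1+n-(i+1 : ℕ) = m+n-i by push_cast; ring]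
  ring

lemma R_zero (n : ℤ) : R 0 n = σ0 n := by
  ext l
  obtain ⟨M, hM⟩ : ∃ M : ℕ, l + n + 5 < M := ⟨(l+n+6).toNat, by omega⟩
  rw [R_coeff, Rc_eq 0 n l (M+1) (by push_cast; omega)]
  unfold Sp
  rw [Finset.sum_range_succ']
  simp [gam_base, gam_zero]

lemma R_main (m n : ℤ) : σ0 m * σ0 n = R m n := by
  induction m using Int.induction_on with
  | zero => rw [R_zero, sig_zero, one_mul]
  | succ i ih => rw [R_succ, sig_succ, mul_assoc, ih]
  | pred i ih =>
    have h := sig_succ (-(i : ℤ) - 1)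
    have h' := R_succ (-(i : ℤ) - 1) n
    rw [sub_add_cancel] at h h'
    rw [h, h', mul_assoc] at ih
    exact mul_left_cancel₀ (facZ_ne _) ih

theorem sigma_multiplication (m n : ℤ) (l : ℤ) :
    {i : ℕ | γ m n i * (σ0 (m + n - i)).coeff l ≠ 0}.Finite ∧
    (σ0 m * σ0 n).coeff l = ∑ᶠ i : ℕ, γ m n i * (σ0 (m + n - i)).coeff l := by
  have hsub : {i : ℕ | γ m n i * (σ0 (m + n - i)).coeff l ≠ 0} ⊆
      ↑(Finset.range (l + m + n + 1).toNat) := by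
    intro i hi
    rw [Finset.coe_range, Set.mem_Iio]
    by_contra h
    exact hi (by rw [sig_coeff _ _ (by omega), mul_zero])
  refine ⟨(Finset.finite_toSet _).subset hsub, ?_⟩
  rw [finsum_eq_sum_of_support_subset _ hsub, R_main, R_coeff]
  rfl
end
end

section
/- Let (a_{−k−1})_{k≥0} be a sequence in ℚ((q)) satisfying the lower bound condition. Then in ℚ(x)((q)) the family (a_{−k−1}·σ̃_{−k−1})_{k≥0} is summable, the family (r_j·(x+x⁻¹−q^j−q^{−j})⁻¹)_{j∈ℤ} is summable (for j ≠ 0, x+x⁻¹−q^j−q^{−j} is a Laurent series in q of order −|j| with nonzero leading coefficient, hence invertible in ℚ(x)((q))), and the pole expansion Σ_{k≥0} a_{−k−1}·σ̃_{−k−1} = (1 − x⁻¹)·Σ_{j∈ℤ} r_j·(x+x⁻¹−q^j−q^{−j})⁻¹ holds. -/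
noncomputable section

/-- The Laurent series variable `q` of `ℚ((q))`. -/
def qq : LaurentSeries ℚ := HahnSeries.single 1 1

/-- `(q)_m = ∏_{i=1}^{m}(1−qⁱ)` in `ℚ((q))`. -/
def qPoch (m : ℕ) : LaurentSeries ℚ := ∏ i ∈ Finset.range m, (1 - qq ^ (i + 1))

/-- `(q)_∞ = ∏_{i≥1}(1−qⁱ)` in `ℚ((q))` (a convergent infinite product for the
`q`-adic topology). -/
def qInf : LaurentSeries ℚ := ∏' i : ℕ, (1 - qq ^ (i + 1))

/-- `ρ_{k,j} = −(−1)^{k+j}·q^{k(k+1)/2+j(j+1)/2}·((q)_{k+j}(q)_{k−j})⁻¹` for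
`k ≥ |j|` (and `0` for `k < |j|`). -/
def ρ (k : ℕ) (j : ℤ) : LaurentSeries ℚ :=
  if (k : ℤ) < |j| then 0
  else -((-1 : LaurentSeries ℚ) ^ ((k : ℤ) + j) *
    qq ^ ((k : ℤ) * ((k : ℤ) + 1) / 2 + j * (j + 1) / 2) *
    (qPoch ((k : ℤ) + j).toNat * qPoch ((k : ℤ) - j).toNat)⁻¹)

/-- The lower bound condition: `δ(a_{−k−1}) ≥ −(k+1)(k−2)/2 + C` for all `k ≥ 0`
(stated coefficientwise, which also covers vanishing terms). -/
def LBC (a : ℕ → LaurentSeries ℚ) (C : ℤ) : Prop :=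
  ∀ k : ℕ, ∀ w : ℤ, 2 * w < -(((k : ℤ) + 1) * ((k : ℤ) - 2)) + 2 * C → (a k).coeff w = 0

/-- The residue series `r_j = Σ_{k≥|j|} a_{−k−1}·ρ_{k,j}`. -/
def resid (a : ℕ → LaurentSeries ℚ) (j : ℤ) : LaurentSeries ℚ := ∑' k : ℕ, a k * ρ k j

/-- The balanced Gaussian binomial `binom[k+i, 2k]`, as a Laurent polynomial in `q`:
`binom[k+i,2k] = q^{k(k−i)}·∏_{j=0}^{2k−1}(q^{k+i−j}−1) / ∏_{j=0}^{2k−1}(q^{2k−j}−1)`. -/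
def bq (i k : ℕ) : LaurentSeries ℚ :=
  qq ^ ((k : ℤ) * ((k : ℤ) - (i : ℤ))) *
    (∏ j ∈ Finset.range (2 * k), (qq ^ ((k : ℤ) + i - j) - 1)) *
    (∏ j ∈ Finset.range (2 * k), (qq ^ ((2 * k : ℤ) - j) - 1))⁻¹

/-- The field `ℚ(x)((q))` of formal Laurent series in `q` over `ℚ(x)`. -/
abbrev LX : Type := LaurentSeries (RatFunc ℚ)

/-- The Laurent series variable `q` in `ℚ(x)((q))`. -/
def qX : LX := HahnSeries.single 1 1

/-- The element `x` of the coefficient field `ℚ(x)`, viewed inside `ℚ(x)((q))`. -/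
def Cx : LX := HahnSeries.C RatFunc.X

/-- `(c;q)_m = ∏_{i=0}^{m−1}(1−c·qⁱ)` in `ℚ(x)((q))`. -/
def pochL (c : LX) (m : ℕ) : LX := ∏ i ∈ Finset.range m, (1 - c * qX ^ i)

/-- `σ̃_{−k−1} = (−1)^k q^{k(k+1)/2}·((x;q)_{k+1}·(qx⁻¹;q)_k)⁻¹ ∈ ℚ(x)((q))`,
the `q`-expansion of `(x⁻¹−1)·∏_{i=0}^{k}(x+x⁻¹−qⁱ−q⁻ⁱ)⁻¹`. -/
def σt (k : ℕ) : LX :=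
  (-1 : LX) ^ k * qX ^ (k * (k + 1) / 2) * (pochL Cx (k + 1) * pochL (qX * Cx⁻¹) k)⁻¹

/-- The coefficientwise embedding `ℚ((q)) → ℚ(x)((q))`. -/
def liftQ (f : LaurentSeries ℚ) : LX := f.map (algebraMap ℚ (RatFunc ℚ))

section AlgPart

variable {F : Type*} [Field F]

def PPg (q : F) (m : ℕ) : F := ∏ i ∈ Finset.range m, (1 - q ^ (i + 1))

def rrg (q : F) (k : ℕ) (j : ℤ) : F :=
  -((-1 : F) ^ ((k : ℤ) + j) * q ^ ((k : ℤ) * ((k : ℤ) + 1) / 2 + j * (j + 1) / 2) *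
    (PPg q ((k : ℤ) + j).toNat * PPg q ((k : ℤ) - j).toNat)⁻¹)

def ttg (q : F) (j : ℤ) : F := q ^ j + q ^ (-j)

lemma ttg_neg (q : F) (j : ℤ) : ttg q (-j) = ttg q j := by
  simp [ttg, add_comm]

lemma PPg_ne (q : F) (hq : ∀ n : ℕ, q ^ (n + 1) ≠ 1) (m : ℕ) : PPg q m ≠ 0 := by
  rw [PPg, Finset.prod_ne_zero_iff]
  intro i _
  exact sub_ne_zero.2 (hq i).symm

lemma PPg_succ (q : F) (m : ℕ) : PPg q (m + 1) = PPg q m * (1 - q ^ (m + 1)) :=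
  Finset.prod_range_succ _ _

lemma ttg_sub (q : F) (h0 : q ≠ 0) (a b : ℤ) :
    ttg q a - ttg q b = q ^ (-a) * (1 - q ^ (a - b)) * (1 - q ^ (a + b)) := by
  simp only [ttg, zpow_sub₀ h0, zpow_add₀ h0, zpow_neg]
  have := zpow_ne_zero a h0
  have := zpow_ne_zero b h0
  field_simp
  ring

lemma rrg_step (q : F) (h0 : q ≠ 0) (hq : ∀ n : ℕ, q ^ (n + 1) ≠ 1) (k : ℕ) (j : ℤ)
    (hj : |j| ≤ k) : rrg q (k + 1) j * (ttg q j - ttg q ((k + 1 : ℕ) : ℤ)) = rrg q k j := by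
  obtain ⟨h1, h2⟩ := abs_le.1 hj
  obtain ⟨m, hm⟩ := Int.eq_ofNat_of_zero_le (show 0 ≤ (k : ℤ) + j by omega)
  obtain ⟨n, hn⟩ := Int.eq_ofNat_of_zero_le (show 0 ≤ (k : ℤ) - j by omega)
  have e1 : ((k + 1 : ℕ) : ℤ) + j = ((m + 1 : ℕ) : ℤ) := by push_cast; omega
  have e2 : ((k + 1 : ℕ) : ℤ) - j = ((n + 1 : ℕ) : ℤ) := by push_cast; omega
  have e3 : ((k + 1 : ℕ) : ℤ) * (((k + 1 : ℕ) : ℤ) + 1) / 2 = (k : ℤ) * ((k : ℤ) + 1) / 2 + (k + 1) := by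
    rw [show ((k + 1 : ℕ) : ℤ) * (((k + 1 : ℕ) : ℤ) + 1) = (k : ℤ) * ((k : ℤ) + 1) + (k + 1) * 2 by
      push_cast; ring]
    exact Int.add_mul_ediv_right _ _ two_ne_zero
  rw [← neg_sub, ttg_sub q h0, rrg, rrg, e1, e2, e3, hm, hn]
  simp only [Int.toNat_natCast, zpow_natCast, PPg_succ]
  rw [add_right_comm, zpow_add₀ h0 _ ((k : ℤ) + 1)]
  have a1 := sub_ne_zero.2 (hq m).symm
  have a2 := sub_ne_zero.2 (hq n).symm
  have a3 := PPg_ne q hq m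
  have a4 := PPg_ne q hq n
  have a5 := pow_ne_zero (k + 1) h0
  have e4 : q ^ ((k : ℤ) + 1) = q ^ (k + 1) := by exact_mod_cast zpow_natCast q (k + 1)
  rw [zpow_neg, zpow_natCast, e4]
  field_simp
  ring

def DDg (q : F) (k i : ℕ) : F :=
  ∏ j ∈ (Finset.range (k + 1)).erase i, (ttg q (i : ℤ) - ttg q (j : ℤ))

lemma DDg_succ (q : F) (k i : ℕ) (h : i ≤ k) :
    DDg q (k + 1) i = DDg q k i * (ttg q (i : ℤ) - ttg q ((k + 1 : ℕ) : ℤ)) := by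
  have : (Finset.range (k + 1 + 1)).erase i = insert (k + 1) ((Finset.range (k + 1)).erase i) := by
    ext x; simp only [Finset.mem_erase, Finset.mem_range, Finset.mem_insert]; omega
  rw [DDg, this, Finset.prod_insert (by simp), mul_comm]; rfl

lemma DDg_base (q : F) (h0 : q ≠ 0) (hq : ∀ n : ℕ, q ^ (n + 1) ≠ 1) (i : ℕ) :
    DDg q (i + 1) (i + 1) * (1 + q ^ (i + 1)) * q ^ ((i + 1) * (i + 1)) = PPg q (2 * (i + 1)) := by
  set k := i + 1 with hk
  have : (Finset.range (k + 1)).erase k = Finset.range k := by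
    ext x; simp only [Finset.mem_erase, Finset.mem_range]; omega
  rw [DDg, this]
  have h1 : ∀ j ∈ Finset.range k, ttg q (k : ℤ) - ttg q (j : ℤ) =
      (q ^ k)⁻¹ * (1 - q ^ (k - 1 - j + 1)) * (1 - q ^ (k + j)) := by
    intro j hj
    have := Finset.mem_range.1 hj
    rw [ttg_sub q h0, zpow_neg, zpow_natCast, ← zpow_natCast, ← zpow_natCast q (k - 1 - j + 1),
      ← zpow_natCast q (k + j)]
    congr 4
    omega
  rw [Finset.prod_congr rfl h1, Finset.prod_mul_distrib, Finset.prod_mul_distrib,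
    Finset.prod_const, Finset.card_range, Finset.prod_range_reflect (fun j => 1 - q ^ (j + 1)) k]
  have h2 : PPg q (2 * k) = PPg q k * ∏ j ∈ Finset.range k, (1 - q ^ (k + j + 1)) := by
    rw [two_mul, PPg, Finset.prod_range_add]; rfl
  have h3 : (∏ j ∈ Finset.range k, (1 - q ^ (k + j))) * (1 - q ^ (k + k)) =
      (∏ j ∈ Finset.range k, (1 - q ^ (k + j + 1))) * (1 - q ^ k) := by
    rw [← Finset.prod_range_succ (fun j => 1 - q ^ (k + j)), Finset.prod_range_succ']
    rfl
  have h4 : (1 - q ^ k) ≠ 0 := sub_ne_zero.2 (hq i).symm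
  have h5 : (∏ j ∈ Finset.range k, (1 - q ^ (k + j))) * (1 + q ^ k) =
      (∏ j ∈ Finset.range k, (1 - q ^ (k + j + 1))) := by
    apply mul_right_cancel₀ h4
    rw [← h3, pow_add]; ring
  rw [h2, ← h5, inv_pow, ← pow_mul]
  change _ * PPg q k * _ * _ * _ = _
  have := pow_ne_zero (k * k) h0
  field_simp

lemma rrg_base (q : F) (h0 : q ≠ 0) (hq : ∀ n : ℕ, q ^ (n + 1) ≠ 1) (i : ℕ) :
    (rrg q (i + 1) ((i + 1 : ℕ) : ℤ) + rrg q (i + 1) (-((i + 1 : ℕ) : ℤ))) * DDg q (i + 1) (i + 1)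
      = -1 := by
  have hD := DDg_base q h0 hq i
  have hP := PPg_ne q hq (2 * (i + 1))
  rw [← hD] at hP
  have e0 : (((i + 1 : ℕ) : ℤ) + ((i + 1 : ℕ) : ℤ)) = ((2 * (i + 1) : ℕ) : ℤ) := by push_cast; ring
  obtain ⟨m, hm⟩ := Int.even_mul_succ_self ((i + 1 : ℕ) : ℤ)
  have e1 : ((i + 1 : ℕ) : ℤ) * (((i + 1 : ℕ) : ℤ) + 1) / 2 = m := by omega
  have e2 : -((i + 1 : ℕ) : ℤ) * (-((i + 1 : ℕ) : ℤ) + 1) / 2 = m - (i + 1 : ℕ) := by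
    rw [show -((i + 1 : ℕ) : ℤ) * (-((i + 1 : ℕ) : ℤ) + 1) = (m - (i + 1 : ℕ)) * 2 by linarith]
    exact Int.mul_ediv_cancel _ two_ne_zero
  have e3 : m + m = ((i + 1) * (i + 1) : ℕ) + (i + 1 : ℕ) := by push_cast at *; linarith
  have e4 : m + (m - (i + 1 : ℕ)) = ((i + 1) * (i + 1) : ℕ) := by omega
  rw [rrg, rrg, sub_neg_eq_add ((i + 1 : ℕ) : ℤ), sub_self, add_neg_cancel ((i + 1 : ℕ) : ℤ), e0, e1, e2, e3, e4,
    zpow_add₀ h0]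
  simp only [Int.toNat_natCast, zpow_natCast, Int.toNat_zero]
  rw [← hD, pow_mul (-1 : F)]
  simp only [PPg, Finset.range_zero, Finset.prod_empty, zpow_zero]
  have n1 := left_ne_zero_of_mul hP
  have n2 := right_ne_zero_of_mul hP
  have n3 := left_ne_zero_of_mul n1
  have n4 := right_ne_zero_of_mul n1
  field_simp
  ring

lemma rrg_DDg (q : F) (h0 : q ≠ 0) (hq : ∀ n : ℕ, q ^ (n + 1) ≠ 1) (i n : ℕ) :
    (rrg q (i + 1 + n) ((i + 1 : ℕ) : ℤ) + rrg q (i + 1 + n) (-((i + 1 : ℕ) : ℤ))) *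
      DDg q (i + 1 + n) (i + 1) = -1 := by
  induction n with
  | zero => exact rrg_base q h0 hq i
  | succ n ih =>
    rw [← ih, ← add_assoc, DDg_succ _ _ _ (by omega),
      ← rrg_step q h0 hq (i + 1 + n) ((i + 1 : ℕ) : ℤ) (by rw [abs_of_nonneg] <;> omega),
      ← rrg_step q h0 hq (i + 1 + n) (-((i + 1 : ℕ) : ℤ)) (by rw [abs_neg, abs_of_nonneg] <;> omega),
      ttg_neg]
    ring

lemma rrg_DDg_zero (q : F) (h0 : q ≠ 0) (hq : ∀ n : ℕ, q ^ (n + 1) ≠ 1) (n : ℕ) :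
    rrg q n 0 * DDg q n 0 = -1 := by
  induction n with
  | zero => simp [rrg, DDg, PPg]
  | succ n ih =>
    rw [← ih, DDg_succ _ _ _ (by omega), ← rrg_step q h0 hq n 0 (by simp)]
    simp only [Nat.cast_zero]
    ring

lemma sum_Icc_sym {M : Type*} [AddCommMonoid M] (f : ℤ → M) (k : ℕ) :
    ∑ j ∈ Finset.Icc (-(k : ℤ)) k, f j =
      f 0 + ∑ i ∈ Finset.range k, (f ((i + 1 : ℕ) : ℤ) + f (-((i + 1 : ℕ) : ℤ))) := by
  induction k with
  | zero => simp
  | succ k ih =>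
    have : Finset.Icc (-((k + 1 : ℕ) : ℤ)) ((k + 1 : ℕ) : ℤ) =
        insert ((k + 1 : ℕ) : ℤ) (insert (-((k + 1 : ℕ) : ℤ)) (Finset.Icc (-(k : ℤ)) k)) := by
      ext x; simp only [Finset.mem_Icc, Finset.mem_insert]; push_cast; omega
    rw [this, Finset.sum_insert, Finset.sum_insert, ih, Finset.sum_range_succ]
    · abel
    · simp only [Finset.mem_Icc]; push_cast; omega
    · simp only [Finset.mem_Icc, Finset.mem_insert]; push_cast; omega

lemma ttg_inj (q : F) (h0 : q ≠ 0) (hq : ∀ n : ℕ, q ^ (n + 1) ≠ 1) (a b : ℕ) (hab : a < b) :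
    ttg q (a : ℤ) ≠ ttg q (b : ℤ) := by
  intro h
  have := ttg_sub q h0 b a
  rw [h, sub_self] at this
  obtain ⟨c, rfl⟩ := Nat.exists_eq_add_of_lt hab
  have h1 : q ^ (((a + c + 1 : ℕ) : ℤ) - a) = q ^ (c + 1) := by
    rw [← zpow_natCast]; congr 1; push_cast; ring
  have h2 : q ^ (((a + c + 1 : ℕ) : ℤ) + a) = q ^ ((a + c + a) + 1) := by
    rw [← zpow_natCast]; congr 1; push_cast; ring
  rw [h1, h2] at this
  exact mul_ne_zero (mul_ne_zero (zpow_ne_zero _ h0) (sub_ne_zero.2 (hq _).symm))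
    (sub_ne_zero.2 (hq _).symm) this.symm

lemma partial_frac (q y : F) (h0 : q ≠ 0) (hq : ∀ n : ℕ, q ^ (n + 1) ≠ 1)
    (hy : ∀ i : ℕ, y ≠ ttg q (i : ℤ)) (k : ℕ) :
    ∏ i ∈ Finset.range (k + 1), (y - ttg q (i : ℤ))⁻¹ =
      - ∑ j ∈ Finset.Icc (-(k : ℤ)) k, rrg q k j * (y - ttg q j)⁻¹ := by
  have hinj : Set.InjOn (fun i : ℕ => ttg q (i : ℤ)) (Finset.range (k + 1)) := by
    intro a _ b _ hab
    rcases lt_trichotomy a b with h | h | h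
    · exact absurd hab (ttg_inj q h0 hq a b h)
    · exact h
    · exact absurd hab.symm (ttg_inj q h0 hq b a h)
  have key := Lagrange.eval_interpolate_not_at_node (s := Finset.range (k + 1))
    (v := fun i : ℕ => ttg q (i : ℤ)) (x := y) 1 (fun i _ => hy i)
  rw [Lagrange.interpolate_one hinj (by simp), Polynomial.eval_one, Lagrange.eval_nodal] at key
  have key2 : ∏ i ∈ Finset.range (k + 1), (y - ttg q (i : ℤ))⁻¹ =
    ∑ i ∈ Finset.range (k + 1), (DDg q k i)⁻¹ * (y - ttg q (i : ℤ))⁻¹ := by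
    rw [Finset.prod_inv_distrib]
    rw [inv_eq_of_mul_eq_one_right key.symm]
    simp [Lagrange.nodalWeight, DDg]
  rw [key2, sum_Icc_sym, Finset.sum_range_succ', neg_add, add_comm, ← Finset.sum_neg_distrib]
  congr 1
  · have h := rrg_DDg_zero q h0 hq k
    have hD : DDg q k 0 ≠ 0 := by intro h'; simp [h'] at h
    rw [← neg_mul]
    simp only [Nat.cast_zero]
    congr 1
    exact (eq_inv_of_mul_eq_one_left (by linear_combination -h)).symm
  · refine Finset.sum_congr rfl fun i hi => ?_
    obtain ⟨n, rfl⟩ := Nat.exists_eq_add_of_le (Nat.succ_le_of_lt (Finset.mem_range.1 hi))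
    have h := rrg_DDg q h0 hq i n
    rw [ttg_neg, ← add_mul, ← neg_mul]
    congr 1
    exact (eq_inv_of_mul_eq_one_left (by linear_combination -h)).symm

end AlgPart

section ValPart

open WithZero Filter Topology

variable {K : Type*} [Field K]

lemma nhds_zero_exists {s : Set (LaurentSeries K)} (hs : s ∈ 𝓝 (0 : LaurentSeries K)) :
    ∃ D : ℤ, ∀ x : LaurentSeries K, Valued.v x ≤ exp (-D) → x ∈ s := by
  obtain ⟨γ, hγ⟩ := Valued.mem_nhds_zero.1 hs
  refine ⟨-(log (MonoidWithZeroHom.ValueGroup₀.embedding γ.1) - 1), fun x hx => hγ ?_⟩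
  change Valued.v.restrict x < γ.1
  rw [Valuation.restrict_lt_iff_lt_embedding]
  refine lt_of_le_of_lt hx ?_
  rw [← lt_log_iff_exp_lt (by simp)]
  simp

lemma ball_mem_nhds_zero (D : ℤ) :
    {x : LaurentSeries K | Valued.v x ≤ exp (-D)} ∈ 𝓝 (0 : LaurentSeries K) := by
  have h0 : (Valued.v.restrict (HahnSeries.single D (1 : K) : LaurentSeries K)) ≠ 0 := by
    rw [ne_eq, Valuation.zero_iff]; simp
  refine Valued.mem_nhds_zero.2 ⟨Units.mk0 _ h0, fun x hx => ?_⟩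
  change Valued.v.restrict x < Valued.v.restrict _ at hx
  rw [Valuation.restrict_lt_iff_lt_embedding] at hx
  simp only [Valuation.embedding_restrict] at hx
  rw [LaurentSeries.valuation_single_zpow] at hx
  exact hx.le

lemma summable_crit {ι : Type*} (f : ι → LaurentSeries K)
    (h : ∀ D : ℤ, {i | ¬ Valued.v (f i) ≤ exp (-D)}.Finite) : Summable f := by
  have : NonarchimedeanAddGroup (LaurentSeries K) := by
    refine ⟨fun U hU => ?_⟩
    obtain ⟨D, hD⟩ := nhds_zero_exists hU
    let V : AddSubgroup (LaurentSeries K) :=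
      { carrier := {x | Valued.v x ≤ exp (-D)}
        zero_mem' := by simp
        add_mem' := fun {x y} hx hy => by
          change Valued.v (x + y) ≤ _
          exact Valuation.map_add_le _ hx hy
        neg_mem' := fun {x} hx => by simpa using hx }
    have hV : IsOpen (V : Set (LaurentSeries K)) :=
      AddSubgroup.isOpen_of_mem_nhds V (ball_mem_nhds_zero D)
    exact ⟨⟨V, hV⟩, fun x hx => hD x hx⟩
  apply NonarchimedeanAddGroup.summable_of_tendsto_cofinite_zero
  intro s hs
  obtain ⟨D, hD⟩ := nhds_zero_exists hs
  rw [mem_map, mem_cofinite]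
  exact (h D).subset fun i hi hi' => hi (hD _ hi')

lemma v_q : Valued.v (HahnSeries.single 1 1 : LaurentSeries K) = exp (-1 : ℤ) :=
  LaurentSeries.valuation_single_zpow K 1

lemma v_q_zpow (n : ℤ) : Valued.v ((HahnSeries.single 1 1 : LaurentSeries K) ^ n) = exp (-n) := by
  rw [map_zpow₀, v_q, ← exp_zsmul]; simp

lemma v_q_pow_lt (n : ℕ) :
    Valued.v ((HahnSeries.single 1 1 : LaurentSeries K) ^ (n + 1)) < 1 := by
  rw [← zpow_natCast, v_q_zpow, ← exp_zero, exp_lt_exp]; push_cast; omega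

lemma q_pow_ne_one (n : ℕ) : (HahnSeries.single 1 1 : LaurentSeries K) ^ (n + 1) ≠ 1 := by
  intro h
  have := v_q_pow_lt (K := K) n
  simp [h] at this

lemma v_PPg (m : ℕ) : Valued.v (PPg (HahnSeries.single 1 1 : LaurentSeries K) m) = 1 := by
  rw [PPg, map_prod]
  exact Finset.prod_eq_one fun i _ => Valuation.map_one_sub_of_lt _ (v_q_pow_lt i)

lemma v_rrg_le (k : ℕ) (j : ℤ) (m : ℤ) (hm : (k : ℤ) * (k + 1) = m + m) :
    Valued.v (rrg (HahnSeries.single 1 1 : LaurentSeries K) k j) ≤ exp (-m) := by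
  have h1 : Valued.v ((-1 : LaurentSeries K) ^ ((k : ℤ) + j)) = 1 := by
    rw [map_zpow₀, Valuation.map_neg, map_one, one_zpow]
  rw [rrg, Valuation.map_neg, map_mul, map_mul, h1, map_inv₀, map_mul, v_PPg, v_PPg, v_q_zpow]
  simp only [one_mul, mul_one, inv_one, exp_le_exp]
  have e1 : (k : ℤ) * (k + 1) / 2 = m := by omega
  have e2 : 0 ≤ j * (j + 1) := by
    rcases le_or_gt 0 j with h | h
    · positivity
    · nlinarith
  have e3 : 0 ≤ j * (j + 1) / 2 := Int.ediv_nonneg e2 (by norm_num)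
  omega

lemma v_C (r : K) (hr : r ≠ 0) : Valued.v (HahnSeries.C r : LaurentSeries K) = 1 := by
  have key : ∀ r : K, Valued.v (HahnSeries.C r : LaurentSeries K) ≤ 1 := by
    intro r
    have := (LaurentSeries.valuation_le_iff_coeff_lt_eq_zero K (D := 0)
      (f := (HahnSeries.C r : LaurentSeries K))).2 (fun n hn => by
        rw [HahnSeries.C_apply, HahnSeries.coeff_single_of_ne hn.ne])
    simpa using this
  refine le_antisymm (key r) ?_
  have h2 : (1 : LaurentSeries K) = HahnSeries.C r * HahnSeries.C r⁻¹ := by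
    rw [← map_mul, mul_inv_cancel₀ hr, map_one]
  rw [← map_one (Valued.v : Valuation (LaurentSeries K) _), h2, map_mul]
  exact mul_le_of_le_one_right' (key _)

end ValPart

section LXPart

open WithZero Filter Topology

def liftHom : LaurentSeries ℚ →+* LX where
  toFun := liftQ
  map_zero' := by ext n; simp [liftQ]
  map_one' := by
    ext n
    by_cases h : n = 0 <;> simp [liftQ, HahnSeries.coeff_one, h]
  map_add' x y := HahnSeries.map_add (algebraMap ℚ (RatFunc ℚ) : ℚ →+ RatFunc ℚ)
  map_mul' x y := HahnSeries.map_mul (algebraMap ℚ (RatFunc ℚ) : ℚ →ₙ+* RatFunc ℚ)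

lemma liftHom_apply (f : LaurentSeries ℚ) : liftHom f = liftQ f := rfl

lemma v_liftQ_le (f : LaurentSeries ℚ) (D : ℤ) (h : Valued.v f ≤ exp (-D)) :
    Valued.v (liftQ f) ≤ exp (-D) := by
  rw [LaurentSeries.valuation_le_iff_coeff_lt_eq_zero] at h ⊢
  intro n hn
  simp [liftQ, h n hn]

lemma continuous_liftHom : Continuous liftHom := by
  apply continuous_of_continuousAt_zero
  rw [ContinuousAt, map_zero]
  intro s hs
  obtain ⟨D, hD⟩ := nhds_zero_exists hs
  rw [mem_map]
  filter_upwards [ball_mem_nhds_zero D] with x hx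
  exact hD _ (v_liftQ_le x D hx)

lemma liftHom_qq : liftHom qq = qX := by
  change liftQ qq = _
  ext n
  by_cases h : n = 1 <;> simp [liftQ, qq, qX, HahnSeries.coeff_single, h]

lemma qX_ne : qX ≠ 0 := by simp [qX]

lemma lift_rrg (k : ℕ) (j : ℤ) : liftHom (rrg qq k j) = rrg qX k j := by
  simp only [rrg, PPg, map_neg, map_mul, map_zpow₀, map_inv₀, map_prod, map_sub, map_one, map_pow,
    liftHom_qq]

lemma rho_eq (k : ℕ) (j : ℤ) (h : |j| ≤ k) : ρ k j = rrg qq k j := by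
  rw [ρ, if_neg (not_lt.2 h)]; rfl

lemma Cx_ne : Cx ≠ 0 := by simp [Cx, RatFunc.X_ne_zero]

lemma Cx_inv : Cx⁻¹ = HahnSeries.C (RatFunc.X⁻¹ : RatFunc ℚ) := by
  rw [Cx, map_inv₀]

lemma RX_ne_one : (RatFunc.X : RatFunc ℚ) ≠ 1 := by
  intro h
  have h1 : algebraMap (Polynomial ℚ) (RatFunc ℚ) Polynomial.X = algebraMap _ _ 1 := by
    rw [RatFunc.algebraMap_X, map_one, h]
  have h2 := congrArg (Polynomial.eval 0) (RatFunc.algebraMap_injective ℚ h1)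
  simp at h2

lemma v_one_sub (r : RatFunc ℚ) (hr : r ≠ 0) (h1 : r ≠ 1) (n : ℕ) :
    Valued.v (1 - HahnSeries.C r * qX ^ n : LX) = 1 := by
  cases n with
  | zero =>
    have : (1 - HahnSeries.C r * qX ^ 0 : LX) = HahnSeries.C (1 - r) := by
      rw [pow_zero, mul_one, map_sub, map_one]
    rw [this]
    exact v_C _ (sub_ne_zero.2 h1.symm)
  | succ n =>
    apply Valuation.map_one_sub_of_lt
    rw [map_mul, v_C r hr, one_mul]
    exact v_q_pow_lt n

lemma y_sub (n : ℕ) : (Cx + Cx⁻¹ - ttg qX (n : ℤ)) * (-(qX ^ n)) =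
    (1 - Cx * qX ^ n) * (1 - Cx⁻¹ * qX ^ n) := by
  have h1 := Cx_ne
  have h2 := pow_ne_zero n qX_ne
  rw [ttg, zpow_neg, zpow_natCast]
  field_simp
  ring

lemma v_one_sub_x (n : ℕ) : Valued.v (1 - Cx * qX ^ n : LX) = 1 :=
  v_one_sub _ RatFunc.X_ne_zero RX_ne_one n

lemma v_one_sub_xinv (n : ℕ) : Valued.v (1 - Cx⁻¹ * qX ^ n : LX) = 1 := by
  rw [Cx_inv]
  exact v_one_sub _ (inv_ne_zero RatFunc.X_ne_zero) (by rw [ne_eq, inv_eq_one]; exact RX_ne_one) n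

lemma y_sub_ne (n : ℕ) : Cx + Cx⁻¹ - ttg qX (n : ℤ) ≠ 0 := by
  intro h
  have := congrArg Valued.v (y_sub n)
  rw [h, zero_mul, map_zero, map_mul, v_one_sub_x, v_one_sub_xinv, one_mul] at this
  exact zero_ne_one this

lemma v_u_nat (n : ℕ) : Valued.v (Cx + Cx⁻¹ - ttg qX (n : ℤ))⁻¹ ≤ 1 := by
  have := congrArg Valued.v (y_sub n)
  rw [map_mul, map_mul, v_one_sub_x, v_one_sub_xinv, one_mul, Valuation.map_neg] at this
  rw [map_inv₀, inv_eq_of_mul_eq_one_right this]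
  rw [← zpow_natCast, qX, v_q_zpow, ← exp_zero, exp_le_exp]; omega

lemma v_u (j : ℤ) : Valued.v (Cx + Cx⁻¹ - ttg qX j)⁻¹ ≤ 1 := by
  rcases Int.eq_nat_or_neg j with ⟨n, rfl | rfl⟩
  · exact v_u_nat n
  · rw [ttg_neg]; exact v_u_nat n

lemma sigma_eq (k : ℕ) : σt k =
    (Cx⁻¹ - 1) * ∏ i ∈ Finset.range (k + 1), (Cx + Cx⁻¹ - ttg qX (i : ℤ))⁻¹ := by
  induction k with
  | zero =>
    have h1 := Cx_ne
    have h2 : (1 - Cx) ≠ 0 := by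
      intro h
      have := v_one_sub_x 0
      rw [pow_zero, mul_one, h, map_zero] at this
      exact zero_ne_one this
    have h3 : (Cx + Cx⁻¹ - 2) = Cx⁻¹ * (1 - Cx) ^ 2 := by field_simp; ring
    have h4 : Cx⁻¹ - 1 = Cx⁻¹ * (1 - Cx) := by field_simp
    simp only [σt, pochL, ttg]
    norm_num
    rw [h3, h4]
    field_simp
  | succ k ih =>
    rw [Finset.prod_range_succ, ← mul_assoc, ← ih]
    have h := y_sub (k + 1)
    have h0 := pow_ne_zero (k + 1) qX_ne
    have h1 : (1 - Cx * qX ^ (k + 1)) ≠ 0 := by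
      intro h
      have := v_one_sub_x (k + 1)
      rw [h, map_zero] at this
      exact zero_ne_one this
    have h2 : (1 - Cx⁻¹ * qX ^ (k + 1)) ≠ 0 := by
      intro h
      have := v_one_sub_xinv (k + 1)
      rw [h, map_zero] at this
      exact zero_ne_one this
    have h3 : (Cx + Cx⁻¹ - ttg qX ((k + 1 : ℕ) : ℤ))⁻¹ =
        -(qX ^ (k + 1)) * ((1 - Cx * qX ^ (k + 1)) * (1 - Cx⁻¹ * qX ^ (k + 1)))⁻¹ := by
      rw [← h]
      have := y_sub_ne (k + 1)
      field_simp
    rw [h3]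
    have e : (k + 1) * (k + 1 + 1) / 2 = k * (k + 1) / 2 + (k + 1) := by
      rw [show (k + 1) * (k + 1 + 1) = k * (k + 1) + (k + 1) * 2 by ring]
      exact Nat.add_mul_div_right _ _ two_pos
    have p1 : pochL Cx (k + 1 + 1) = pochL Cx (k + 1) * (1 - Cx * qX ^ (k + 1)) :=
      Finset.prod_range_succ _ _
    have p2 : pochL (qX * Cx⁻¹) (k + 1) = pochL (qX * Cx⁻¹) k * (1 - Cx⁻¹ * qX ^ (k + 1)) := by
      rw [pochL, Finset.prod_range_succ, pow_succ' qX k, ← mul_assoc, mul_comm qX]; rfl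
    rw [σt, σt, e, p1, p2, pow_succ (-1 : LX), pow_add qX]
    simp only [mul_inv]
    ring

lemma sigma_sum (k : ℕ) : σt k = (1 - Cx⁻¹) *
    ∑ j ∈ Finset.Icc (-(k : ℤ)) k, rrg qX k j * (Cx + Cx⁻¹ - ttg qX j)⁻¹ := by
  rw [sigma_eq, partial_frac qX _ qX_ne (fun n => q_pow_ne_one n)
    (fun i => sub_ne_zero.1 (y_sub_ne i))]
  ring

lemma v_a_le (a : ℕ → LaurentSeries ℚ) (C : ℤ) (h : LBC a C) (k : ℕ) (m : ℤ)
    (hm : (k : ℤ) * (k + 1) = m + m) : Valued.v (a k) ≤ exp (-(C + k + 1 - m)) := by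
  rw [LaurentSeries.valuation_le_iff_coeff_lt_eq_zero]
  intro n hn
  apply h
  linarith

lemma v_term (a : ℕ → LaurentSeries ℚ) (C : ℤ) (h : LBC a C) (k : ℕ) (j : ℤ) :
    Valued.v (a k * ρ k j) ≤ exp (-(C + k + 1)) := by
  obtain ⟨m, hm⟩ := Int.even_mul_succ_self (k : ℤ)
  rcases lt_or_ge (k : ℤ) |j| with hj | hj
  · rw [ρ, if_pos hj, mul_zero, map_zero]; exact zero_le
  · rw [rho_eq k j hj, map_mul]
    refine (mul_le_mul' (v_a_le a C h k m hm) (v_rrg_le k j m hm)).trans ?_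
    rw [← exp_add, exp_le_exp]; linarith

lemma finite_aux (C D : ℤ) {K : Type*} [Field K] (f : ℕ → LaurentSeries K)
    (h : ∀ k : ℕ, Valued.v (f k) ≤ exp (-(C + k + 1))) :
    {i | ¬ Valued.v (f i) ≤ exp (-D)}.Finite := by
  refine (Set.finite_Iio (D - C).toNat).subset fun k hk => ?_
  by_contra hk'
  refine hk ((h k).trans (exp_le_exp.2 ?_))
  simp only [Set.mem_Iio, not_lt] at hk'
  omega

lemma summable_resid (a : ℕ → LaurentSeries ℚ) (C : ℤ) (h : LBC a C) (j : ℤ) :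
    Summable (fun k : ℕ => a k * ρ k j) :=
  summable_crit _ fun D => finite_aux C D _ fun k => v_term a C h k j

def FF (a : ℕ → LaurentSeries ℚ) (p : ℕ × ℤ) : LX :=
  liftQ (a p.1 * ρ p.1 p.2) * (Cx + Cx⁻¹ - ttg qX p.2)⁻¹

lemma FF_zero (a : ℕ → LaurentSeries ℚ) (k : ℕ) (j : ℤ) (h : (k : ℤ) < |j|) : FF a (k, j) = 0 := by
  rw [FF, ρ, if_pos h, mul_zero, ← liftHom_apply, map_zero, zero_mul]

lemma summable_FF (a : ℕ → LaurentSeries ℚ) (C : ℤ) (h : LBC a C) : Summable (FF a) := by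
  refine summable_crit _ fun D => ?_
  refine ((Set.finite_Iio (D - C).toNat).prod
    (Set.finite_Icc (-((D - C).toNat : ℤ)) ((D - C).toNat : ℤ))).subset ?_
  rintro ⟨k, j⟩ hk
  change ¬ _ at hk
  have hj : |j| ≤ k := by
    by_contra h'
    rw [FF_zero a k j (not_le.1 h'), map_zero] at hk
    exact hk zero_le
  have hkD : k < (D - C).toNat := by
    by_contra hk'
    apply hk
    rw [FF, map_mul]
    refine (mul_le_mul' (v_liftQ_le _ _ (v_term a C h k j)) (v_u j)).trans ?_
    rw [mul_one, exp_le_exp]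
    omega
  have := abs_le.1 hj
  simp only [Set.mem_prod, Set.mem_Iio, Set.mem_Icc]
  omega

end LXPart

/-!
STATEMENT 2: Let (a_{−k−1})_{k≥0} be a sequence in ℚ((q)) satisfying the lower
bound condition.  Then in ℚ(x)((q)) the family (a_{−k−1}·σ̃_{−k−1})_{k≥0} is
summable, the family (r_j·(x+x⁻¹−q^j−q^{−j})⁻¹)_{j∈ℤ} is summable, and the pole
expansion
Σ_{k≥0} a_{−k−1}·σ̃_{−k−1} = (1 − x⁻¹)·Σ_{j∈ℤ} r_j·(x+x⁻¹−q^j−q^{−j})⁻¹ holds.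
(Summability of the residue series defining r_j in ℚ((q)) is included.)
-/

theorem pole_expansion_of_inverted_Habiro_series
    (a : ℕ → LaurentSeries ℚ) (C : ℤ) (h : LBC a C) :
    (∀ j : ℤ, Summable (fun k : ℕ => a k * ρ k j)) ∧
    Summable (fun k : ℕ => liftQ (a k) * σt k) ∧
    Summable (fun j : ℤ => liftQ (resid a j) * (Cx + Cx⁻¹ - qX ^ j - qX ^ (-j))⁻¹) ∧
    ∑' k : ℕ, liftQ (a k) * σt k =
      (1 - Cx⁻¹) * ∑' j : ℤ, liftQ (resid a j) * (Cx + Cx⁻¹ - qX ^ j - qX ^ (-j))⁻¹ := by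
  have hS := (summable_FF a C h).hasSum
  set S := ∑' p, FF a p with hSdef
  have hA : HasSum (fun k : ℕ => ∑ j ∈ Finset.Icc (-(k : ℤ)) k, FF a (k, j)) S := by
    refine hS.prod_fiberwise fun k => ?_
    refine hasSum_sum_of_ne_finset_zero fun j hj => FF_zero a k j ?_
    by_contra h'
    exact hj (Finset.mem_Icc.2 (abs_le.1 (not_lt.1 h')))
  have hA' : HasSum (fun k : ℕ => liftQ (a k) * σt k) ((1 - Cx⁻¹) * S) := by
    convert! hA.mul_left (1 - Cx⁻¹) using 2 with k
    rw [sigma_sum, mul_left_comm, Finset.mul_sum]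
    congr 1
    refine Finset.sum_congr rfl fun j hj => ?_
    rw [FF, ← lift_rrg, rho_eq k j (abs_le.2 (Finset.mem_Icc.1 hj)), ← liftHom_apply,
      ← liftHom_apply, map_mul, mul_assoc]
  have hB : HasSum (fun j : ℤ => liftQ (resid a j) * (Cx + Cx⁻¹ - qX ^ j - qX ^ (-j))⁻¹) S := by
    have hS' : HasSum (fun p : ℤ × ℕ => FF a (p.2, p.1)) S :=
      (Equiv.prodComm ℤ ℕ).hasSum_iff.2 hS
    refine hS'.prod_fiberwise fun j => ?_
    have h1 : HasSum (fun k : ℕ => liftQ (a k * ρ k j)) (liftQ (resid a j)) :=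
      (summable_resid a C h j).hasSum.map liftHom continuous_liftHom
    have h2 := h1.mul_right (Cx + Cx⁻¹ - qX ^ j - qX ^ (-j))⁻¹
    convert! h2 using 2 with k
    rw [FF, ttg, sub_sub]
  refine ⟨summable_resid a C h, hA'.summable, hB.summable, ?_⟩
  rw [hA'.tsum_eq, hB.tsum_eq]
end
end

section
/- Let (a_{−k−1})_{k≥0} be a sequence in ℚ((v)) such that δ_v(a_{−k−1}) ≥ −(k+1)(k−2) + C for all k ≥ 0, for some constant C. Define f_i = Σ_{k=0}^{i} binom[k+i, 2k]·a_{−k−1} for i ≥ 0 (identifying the Laurent polynomial binom[k+i,2k] with its image in ℚ((v))). Then δ_v(f_i) ≥ −i(i−1) + C + 2 for all i ≥ 0. -/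
/-!
STATEMENT 6: Let (a_{−k−1})_{k≥0} be a sequence in ℚ((v)) such that
δ_v(a_{−k−1}) ≥ −(k+1)(k−2) + C for all k ≥ 0, for some constant C.  Define
f_i = Σ_{k=0}^{i} binom[k+i, 2k]·a_{−k−1}.  Then δ_v(f_i) ≥ −i(i−1) + C + 2 for
all i ≥ 0.

The condition δ_v(f) ≥ d is rendered as: the coefficient of v^w in f vanishes for
all w < d (this also covers f = 0, where δ_v(0) = ∞).
-/

noncomputable section

section Helpers

open scoped RatFunc
open RatFunc

abbrev toL : RatFunc ℚ →+* LaurentSeries ℚ := algebraMap (RatFunc ℚ) (LaurentSeries ℚ)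

lemma toL_V_zpow (n : ℤ) : toL (V ^ n) = HahnSeries.single n 1 := by
  rw [map_zpow₀, V, toL, RatFunc.coe_X, ← RatFunc.single_zpow]

lemma toL_sm (n : ℤ) : toL (sm n) = HahnSeries.single n 1 - HahnSeries.single (-n) 1 := by
  rw [sm, map_sub, toL_V_zpow, toL_V_zpow]

lemma toL_sm_order (n : ℤ) (hn : 0 < n) : toL (sm n) ≠ 0 ∧ (toL (sm n)).order = -n := by
  have hc : (toL (sm n)).coeff (-n) ≠ 0 := by
    rw [toL_sm, HahnSeries.coeff_sub, HahnSeries.coeff_single_same,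
      HahnSeries.coeff_single_of_ne (by omega)]
    norm_num
  have h0 : toL (sm n) ≠ 0 := by
    intro h
    rw [h] at hc
    exact hc rfl
  refine ⟨h0, le_antisymm (HahnSeries.order_le_of_coeff_ne_zero hc) ?_⟩
  rw [HahnSeries.le_order_iff_forall h0]
  intro j hj
  rw [toL_sm, HahnSeries.coeff_sub, HahnSeries.coeff_single_of_ne (by omega),
      HahnSeries.coeff_single_of_ne (by omega), sub_zero]

lemma toL_smP_order (n : ℤ) (k : ℕ) (h : (k : ℤ) ≤ n) :
    toL (smP n k) ≠ 0 ∧ 2 * (toL (smP n k)).order = -((k : ℤ) * (2 * n - k + 1)) := by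
  induction k with
  | zero => simp [smP]
  | succ k ih =>
    push_cast at h ⊢
    obtain ⟨i1, i2⟩ := ih (by omega)
    obtain ⟨j1, j2⟩ := toL_sm_order (n - k) (by omega)
    have e : smP n (k + 1) = smP n k * sm (n - k) := by
      simp [smP, Finset.prod_range_succ]
    rw [e, map_mul]
    refine ⟨mul_ne_zero i1 j1, ?_⟩
    rw [HahnSeries.order_mul i1 j1, mul_add, i2, j2]
    ring

lemma toL_bbinom_order (n : ℤ) (k : ℕ) (h : (k : ℤ) ≤ n) :
    toL (bbinom n k) ≠ 0 ∧ (toL (bbinom n k)).order = -((k : ℤ) * (n - k)) := by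
  obtain ⟨i1, i2⟩ := toL_smP_order n k h
  obtain ⟨j1, j2⟩ := toL_smP_order k k le_rfl
  have h0 : toL (bbinom n k) ≠ 0 := by
    rw [bbinom, map_div₀]
    exact div_ne_zero i1 j1
  refine ⟨h0, ?_⟩
  have e : toL (smP n k) = toL (bbinom n k) * toL (smP k k) := by
    rw [bbinom, map_div₀, div_mul_cancel₀ _ j1]
  rw [e, HahnSeries.order_mul h0 j1] at i2
  linarith

end Helpers

theorem LBC_implies_FK_growth (a : ℕ → LaurentSeries ℚ) (C : ℤ)
    (ha : ∀ k : ℕ, ∀ w : ℤ, w < -((k : ℤ) + 1) * ((k : ℤ) - 2) + C → (a k).coeff w = 0)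
    (f : ℕ → LaurentSeries ℚ)
    (hf : ∀ i : ℕ, f i = ∑ k ∈ Finset.range (i + 1),
      (↑(bbinom ((k : ℤ) + i) (2 * k)) : LaurentSeries ℚ) * a k) :
    ∀ i : ℕ, ∀ w : ℤ, w < -(i : ℤ) * ((i : ℤ) - 1) + C + 2 → (f i).coeff w = 0 := by
  intro i w hw
  rw [hf, HahnSeries.coeff_sum]
  refine Finset.sum_eq_zero fun k hk => ?_
  have hk' : k ≤ i := by
    have := Finset.mem_range.mp hk
    omega
  obtain ⟨h0, ho⟩ := toL_bbinom_order ((k : ℤ) + i) (2 * k) (by push_cast; omega)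
  by_cases hak : a k = 0
  · rw [hak, mul_zero]
    rfl
  apply HahnSeries.coeff_eq_zero_of_lt_order
  have h1 : -((k : ℤ) + 1) * ((k : ℤ) - 2) + C ≤ (a k).order := by
    rw [HahnSeries.le_order_iff_forall hak]
    exact fun j hj => ha k j hj
  rw [HahnSeries.order_mul h0 hak, ho]
  push_cast
  obtain ⟨d, rfl⟩ := Nat.exists_eq_add_of_le hk'
  push_cast at hw ⊢
  have h2 : (0 : ℤ) ≤ d * (d - 1) := by
    rcases Nat.eq_zero_or_pos d with h | h
    · simp [h]
    · have : (1 : ℤ) ≤ d := by exact_mod_cast h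
      nlinarith
  nlinarith
end
end

section
/- Let (a_{−k−1})_{k≥0} be a sequence in ℚ((q)) satisfying the lower bound condition, and set f_i = Σ_{k=0}^{i} binom[k+i, 2k]·a_{−k−1} ∈ ℚ((q)). Then in ℚ(x)((q)) the families (a_{−k−1}·σ̃_{−k−1})_{k≥0} and (f_i·θ_i(x))_{i≥0} are summable (their q-orders tend to +∞) and Σ_{k=0}^{∞} a_{−k−1}·σ̃_{−k−1} = ((q,x,qx⁻¹;q)_∞)⁻¹ · Σ_{i=0}^{∞} f_i·θ_i(x). (In other words, the inverted Habiro series equals the theta-regularized form of the Gukov–Manolescu series.) -/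
noncomputable section

/-- `θ_i(x) = (−1)ⁱ q^{i(i+1)/2}·(1 + Σ_{n≥1}(−1)ⁿ q^{n(n+1)/2+n·i}(xⁿ+x⁻ⁿ))`
in `ℚ(x)((q))`. -/
def θ (i : ℕ) : LX :=
  (-1 : LX) ^ i * qX ^ (i * (i + 1) / 2) *
    (1 + ∑' n : ℕ, (-1 : LX) ^ (n + 1) * qX ^ ((n + 1) * (n + 2) / 2 + (n + 1) * i) *
      (Cx ^ (n + 1) + Cx⁻¹ ^ (n + 1)))

/-- `(q,x,qx⁻¹;q)_∞ = ∏_{n≥1}(1−qⁿ)·∏_{n≥0}(1−xqⁿ)·∏_{n≥1}(1−x⁻¹qⁿ)`, a convergent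
infinite product in `ℚ(x)((q))`. -/
def pochInf : LX :=
  (∏' n : ℕ, (1 - qX ^ (n + 1))) * (∏' n : ℕ, (1 - Cx * qX ^ n)) *
    (∏' n : ℕ, (1 - Cx⁻¹ * qX ^ (n + 1)))

namespace IHS
open Filter Topology WithZero

/-- order at least `n`. -/
def Od (n : ℤ) (F : LX) : Prop := Valued.v F ≤ (exp (-n) : WithZero (Multiplicative ℤ))

lemma Od_iff {n : ℤ} {F : LX} : Od n F ↔ ∀ w : ℤ, w < n → F.coeff w = 0 :=
  LaurentSeries.valuation_le_iff_coeff_lt_eq_zero (RatFunc ℚ)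

lemma Od.mono {m n : ℤ} {F : LX} (h : Od n F) (hm : m ≤ n) : Od m F :=
  le_trans h (exp_le_exp.2 (by omega))

lemma Od.add {n : ℤ} {F G : LX} (h : Od n F) (h' : Od n G) : Od n (F + G) :=
  Valuation.map_add_le _ h h'

lemma Od.neg {n : ℤ} {F : LX} (h : Od n F) : Od n (-F) := by
  unfold Od at *; rwa [Valuation.map_neg]

lemma Od.sub {n : ℤ} {F G : LX} (h : Od n F) (h' : Od n G) : Od n (F - G) := by
  rw [sub_eq_add_neg]; exact h.add h'.neg

lemma Od.mul {m n : ℤ} {F G : LX} (h : Od m F) (h' : Od n G) : Od (m + n) (F * G) := by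
  unfold Od at *
  rw [map_mul, neg_add, exp_add]
  exact mul_le_mul' h h'

lemma Od.mul' {m n l : ℤ} {F G : LX} (h : Od m F) (h' : Od n G) (hl : l ≤ m + n) : Od l (F * G) :=
  (h.mul h').mono hl

lemma Od_zero (n : ℤ) : Od n 0 := by simp [Od]

lemma Od_one : Od 0 1 := by simp [Od]

lemma v_qX : Valued.v qX = (exp (-1) : WithZero (Multiplicative ℤ)) :=
  LaurentSeries.valuation_single_zpow (RatFunc ℚ) 1

lemma qX_ne : qX ≠ 0 := by
  intro h
  have := v_qX
  rw [h, map_zero] at this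
  exact exp_ne_zero this.symm

lemma Od_zpow (n : ℤ) : Od n (qX ^ n) := by
  unfold Od
  rw [map_zpow₀, v_qX, ← exp_zsmul]
  simp

lemma Od_pow (n : ℕ) : Od n (qX ^ n) := by
  have := Od_zpow n
  simpa using this

lemma v_C (c : RatFunc ℚ) (hc : c ≠ 0) : Valued.v (HahnSeries.C c : LX) = 1 := by
  have h1 : Od 0 (HahnSeries.C c : LX) := Od_iff.2 (fun w hw => by
    simp [HahnSeries.C_apply, HahnSeries.coeff_single_of_ne hw.ne])
  have h2 : Od 0 (HahnSeries.C c⁻¹ : LX) := Od_iff.2 (fun w hw => by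
    simp [HahnSeries.C_apply, HahnSeries.coeff_single_of_ne hw.ne])
  have h3 : (HahnSeries.C c : LX) * HahnSeries.C c⁻¹ = 1 := by
    rw [← map_mul, mul_inv_cancel₀ hc, map_one]
  have h4 := congrArg Valued.v h3
  simp only [Od, neg_zero, exp_zero] at h1 h2
  rw [map_mul, map_one] at h4
  refine le_antisymm h1 ?_
  rw [← h4]
  exact (mul_le_mul' le_rfl h2).trans (by simp)

lemma v_Cx : Valued.v Cx = (1 : WithZero (Multiplicative ℤ)) := v_C _ RatFunc.X_ne_zero

lemma Cx_ne : Cx ≠ 0 := by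
  intro h
  have := v_Cx
  simp [h] at this

lemma v_one_sub_Cx : Valued.v (1 - Cx) = (1 : WithZero (Multiplicative ℤ)) := by
  have : (1 - Cx : LX) = HahnSeries.C (1 - RatFunc.X) := by simp [Cx]
  rw [this]
  refine v_C _ (fun h => ?_)
  have h2 : (RatFunc.X : RatFunc ℚ) = 1 := (sub_eq_zero.1 h).symm
  have h3 := congrArg RatFunc.num h2
  simp only [RatFunc.num_X, RatFunc.num_one] at h3
  exact Polynomial.X_ne_C (1 : ℚ) (by simpa using h3)

lemma v_one_sub {F : LX} (h : Od 1 F) : Valued.v (1 - F) = (1 : WithZero (Multiplicative ℤ)) := by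
  apply Valuation.map_one_sub_of_lt
  refine lt_of_le_of_lt h ?_
  rw [← exp_zero]; exact exp_lt_exp.2 (by omega)

lemma Od_of_v {F : LX} (h : Valued.v F = (1 : WithZero (Multiplicative ℤ))) : Od 0 F := by
  simp [Od, h]

lemma Od_inv_of_v {F : LX} (h : Valued.v F = (1 : WithZero (Multiplicative ℤ))) : Od 0 F⁻¹ := by
  simp [Od, h]

lemma ne_of_v {F : LX} (h : Valued.v F = (1 : WithZero (Multiplicative ℤ))) : F ≠ 0 := by
  rintro rfl; simp at h

lemma Od_Cx_pow (n : ℕ) : Od 0 (Cx ^ n) := Od_of_v (by simp [v_Cx])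
lemma Od_Cx_inv_pow (n : ℕ) : Od 0 (Cx⁻¹ ^ n) := Od_of_v (by simp [v_Cx])

/-- neighbourhoods -/
lemma mem_nhds_zero {s : Set LX} (hs : s ∈ 𝓝 (0 : LX)) : ∃ n : ℤ, ∀ F, Od n F → F ∈ s := by
  obtain ⟨γ, h⟩ := Valued.mem_nhds_zero.1 hs
  refine ⟨-(log (MonoidWithZeroHom.ValueGroup₀.embedding γ.1) - 1), fun F hF => h ?_⟩
  show Valued.v.restrict F < γ.1
  rw [Valuation.restrict_lt_iff_lt_embedding]
  refine lt_of_le_of_lt hF ?_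
  rw [← lt_log_iff_exp_lt (by simp)]
  simp

lemma tendsto_zero {ι : Type*} {l : Filter ι} {F : ι → LX}
    (h : ∀ n : ℤ, ∀ᶠ i in l, Od n (F i)) : Tendsto F l (𝓝 0) := by
  intro s hs
  obtain ⟨n, hn⟩ := mem_nhds_zero hs
  exact (h n).mono (fun i hi => hn _ hi)

lemma isClosed_Od (n : ℤ) : IsClosed {F : LX | Od n F} := by
  have : {F : LX | Od n F} = ⋂ w : ℤ, ⋂ _ : w < n, {F : LX | F.coeff w = 0} := by
    ext F; simp [Od_iff]
  rw [this]
  refine isClosed_iInter fun w => isClosed_iInter fun _ => ?_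
  let _ : UniformSpace (RatFunc ℚ) := ⊥
  have : DiscreteTopology (RatFunc ℚ) := ⟨rfl⟩
  have hc := (LaurentSeries.uniformContinuous_coeff (K := RatFunc ℚ) w).continuous
  exact (isClosed_discrete ({0} : Set (RatFunc ℚ))).preimage hc

lemma Od_sum {ι : Type*} {F : ι → LX} {n : ℤ} (s : Finset ι) (h : ∀ i ∈ s, Od n (F i)) :
    Od n (∑ i ∈ s, F i) := by
  exact Valuation.map_sum_le _ h

lemma Od_tsum {ι : Type*} {F : ι → LX} {n : ℤ} (h : ∀ i, Od n (F i)) : Od n (∑' i, F i) := by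
  by_cases hs : Summable F
  · exact (isClosed_Od n).mem_of_tendsto hs.hasSum
      (Eventually.of_forall fun s => Od_sum s fun i _ => h i)
  · rw [tsum_eq_zero_of_not_summable hs]; exact Od_zero n

lemma na : NonarchimedeanAddGroup LX where
  is_nonarchimedean U hU := by
    obtain ⟨γ, h⟩ := Valued.mem_nhds_zero.1 hU
    exact ⟨⟨Valuation.ltAddSubgroup Valued.v.restrict γ, Valued.isOpen_ball _ _⟩, h⟩

lemma summable_of {ι : Type*} {F : ι → LX} (h : ∀ n : ℤ, {i | ¬ Od n (F i)}.Finite) :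
    Summable F := by
  have : NonarchimedeanAddGroup LX := na
  apply NonarchimedeanAddGroup.summable_of_tendsto_cofinite_zero
  exact tendsto_zero (fun n => h n)

lemma summable_nat {F : ℕ → LX} (g : ℕ → ℤ) (c : ℤ) (h : ∀ i, Od (g i) (F i))
    (hg : ∀ i : ℕ, (i : ℤ) ≤ 2 * g i + c) : Summable F := by
  refine summable_of fun n => (Set.finite_lt_nat (2 * n + c).toNat).subset fun i hi => ?_
  simp only [Set.mem_ofPred_eq] at hi ⊢
  by_contra hlt
  exact hi ((h i).mono (by have := hg i; omega))

lemma summable_prod {F : ℕ × ℕ → LX} (g : ℕ × ℕ → ℤ) (c : ℤ) (h : ∀ i, Od (g i) (F i))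
    (hg : ∀ i, (i.1 : ℤ) + i.2 ≤ 2 * g i + c) : Summable F := by
  refine summable_of fun n => ((Set.finite_lt_nat (2 * n + c).toNat).prod
    (Set.finite_lt_nat (2 * n + c).toNat)).subset fun i hi => ?_
  simp only [Set.mem_ofPred_eq, Set.mem_prod] at hi ⊢
  by_contra hlt
  exact hi ((h i).mono (by have := hg i; omega))

lemma tendsto_of_sub {F : ℕ → LX} {L : LX} (h : ∀ n : ℕ, Od n (F n - L)) :
    Tendsto F atTop (𝓝 L) := by
  have : Tendsto (fun n => F n - L) atTop (𝓝 0) := by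
    refine tendsto_zero fun n => ?_
    filter_upwards [eventually_ge_atTop n.toNat] with m hm
    exact (h m).mono (by omega)
  simpa using this.add_const L

lemma Od_prod {ι : Type*} (s : Finset ι) {f : ι → LX} (h : ∀ i ∈ s, Od 0 (f i)) :
    Od 0 (∏ i ∈ s, f i) := by
  classical
  induction s using Finset.induction_on with
  | empty => simpa using Od_one
  | insert a s ha ih =>
    rw [Finset.prod_insert ha]
    exact (h a (by simp)).mul' (ih fun i hi => h i (by simp [hi])) (by simp)

lemma Od_prod_sub_one {ι : Type*} (s : Finset ι) {f : ι → LX} {n : ℤ} (hn : 0 ≤ n)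
    (h : ∀ i ∈ s, Od n (f i - 1)) :
    Od n (∏ i ∈ s, f i - 1) := by
  classical
  induction s using Finset.induction_on with
  | empty => simpa using Od_zero n
  | insert a s ha ih =>
    rw [Finset.prod_insert ha]
    have h1 := h a (by simp)
    have h2 := ih fun i hi => h i (by simp [hi])
    have : f a * ∏ i ∈ s, f i - 1 = (f a - 1) * (∏ i ∈ s, f i - 1) + (f a - 1)
      + (∏ i ∈ s, f i - 1) := by ring
    rw [this]
    exact ((h1.mul' h2 (by omega)).add h1).add h2

/-- infinite products converge -/
lemma hasProd_nat {f : ℕ → LX} (h0 : ∀ n, Od 0 (f n)) (h : ∀ n : ℕ, Od n (f n - 1)) :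
    Multipliable f ∧ ∀ n : ℕ, Od n (∏ i ∈ Finset.range n, f i - ∏' i, f i) := by
  set P : ℕ → LX := fun n => ∏ i ∈ Finset.range n, f i with hP
  have hP0 : ∀ n, Od 0 (P n) := fun n => Od_prod _ fun i _ => h0 i
  have key : ∀ n : ℕ, ∀ s : Finset ℕ, Finset.range n ⊆ s → Od n (∏ i ∈ s, f i - P n) := by
    intro n s hs
    have : ∏ i ∈ s, f i - P n = P n * (∏ i ∈ s \ Finset.range n, f i - 1) := by
      rw [← Finset.prod_sdiff hs]; ring
    rw [this]
    refine (hP0 n).mul' (Od_prod_sub_one _ (n := n) (by omega) fun i hi => ?_) (by simp)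
    refine (h i).mono ?_
    simp at hi; omega
  have hd : ∀ n : ℕ, Od n (P (n + 1) - P n) := fun n =>
    key n _ (Finset.range_subset_range.2 (by omega))
  have hs : Summable fun n => P (n + 1) - P n :=
    summable_nat (fun n => n) 0 hd (by intro i; omega)
  obtain ⟨L, hL⟩ : ∃ L, Tendsto P atTop (𝓝 L) := by
    have := hs.hasSum.tendsto_sum_nat
    simp_rw [Finset.sum_range_sub] at this
    exact ⟨_, by simpa using this.add_const (P 0)⟩
  have hLn : ∀ n : ℕ, Od n (P n - L) := by
    intro n
    have h1 : Tendsto (fun m => P n - P m) atTop (𝓝 (P n - L)) := hL.const_sub _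
    refine (isClosed_Od n).mem_of_tendsto h1 ?_
    filter_upwards [eventually_ge_atTop n] with m hm
    have := (key n (Finset.range m) (Finset.range_subset_range.2 hm)).neg
    simpa [hP] using this
  have hprod : HasProd f L := by
    show Tendsto (fun s => ∏ i ∈ s, f i) _ _
    have : Tendsto (fun s => ∏ i ∈ s, f i - L) (atTop : Filter (Finset ℕ)) (𝓝 0) := by
      refine tendsto_zero fun n => ?_
      filter_upwards [eventually_ge_atTop (Finset.range n.toNat)] with s hs
      have h2 := (key _ s hs).add (hLn n.toNat)
      rw [sub_add_sub_cancel] at h2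
      exact h2.mono (by omega)
    simpa using this.add_const L
  exact ⟨hprod.multipliable, fun n => by rw [hprod.tprod_eq]; exact hLn n⟩

lemma tri2 (m : ℕ) : 2 * (m * (m + 1) / 2) = m * (m + 1) :=
  Nat.two_mul_div_two_of_even (Nat.even_mul_succ_self m)

lemma tri2z (m : ℕ) : 2 * ((m * (m + 1) / 2 : ℕ) : ℤ) = (m : ℤ) * (m + 1) := by
  exact_mod_cast tri2 m

lemma tri_ge (m : ℕ) : m ≤ m * (m + 1) / 2 := by
  have := tri2 m
  rcases m with _ | m
  · simp
  · nlinarith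

/-- signed triangular powers -/
def T (m : ℕ) : LX := (-1) ^ m * qX ^ (m * (m + 1) / 2)

lemma T_add (i n : ℕ) : T (i + n) = T i * T n * qX ^ (i * n) := by
  have h : (i + n) * (i + n + 1) / 2 = i * (i + 1) / 2 + n * (n + 1) / 2 + i * n := by
    apply Nat.eq_of_mul_eq_mul_left (show 0 < 2 by norm_num)
    have h1 := tri2 i
    have h2 := tri2 n
    have h3 := tri2 (i + n)
    rw [h3]; nlinarith
  unfold T
  rw [h, pow_add, pow_add, pow_add]; ring

lemma Od_neg_one_pow (m : ℕ) : Od 0 ((-1) ^ m) := Od_of_v (by simp)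

lemma Od_T (m : ℕ) : Od ((m * (m + 1) / 2 : ℕ) : ℤ) (T m) :=
  (Od_neg_one_pow m).mul' (Od_pow _) (by simp)

lemma T_ne (m : ℕ) : T m ≠ 0 := mul_ne_zero (by simp) (pow_ne_zero _ qX_ne)

/-- symmetric powers of x -/
def y (n : ℕ) : LX := Cx ^ n + Cx⁻¹ ^ n

lemma Od_y (n : ℕ) : Od 0 (y n) := (Od_Cx_pow n).add (Od_Cx_inv_pow n)

lemma y_rec (n : ℕ) : y 1 * y (n + 1) = y (n + 2) + y n := by
  have := Cx_ne
  unfold y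
  have h : Cx * Cx⁻¹ = 1 := mul_inv_cancel₀ this
  linear_combination (Cx ^ n + Cx⁻¹ ^ n) * h

lemma sumT (i : ℕ) : Summable fun n => T (i + n) * y n := by
  refine summable_nat (fun n => i + n) 0 (fun n => ?_) (by intro n; omega)
  refine (Od_T (i + n)).mul' (Od_y n) ?_
  have := tri_ge (i + n)
  omega

/-- full theta sums -/
def Th (i : ℕ) : LX := ∑' n, T (i + n) * y n

/-- normalized theta -/
def th (i : ℕ) : LX := 1 + ∑' n : ℕ, (-1 : LX) ^ (n + 1) *
  qX ^ ((n + 1) * (n + 2) / 2 + (n + 1) * i) * (Cx ^ (n + 1) + Cx⁻¹ ^ (n + 1))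

lemma θ_eq (i : ℕ) : θ i = T i * th i := rfl

lemma Th_eq (i : ℕ) : Th i = 2 * T i + ∑' n, T (i + (n + 1)) * y (n + 1) := by
  unfold Th
  rw [(sumT i).tsum_eq_zero_add]
  simp [y]; ring

lemma θ_eq' (i : ℕ) : θ i = Th i - T i := by
  rw [θ_eq, Th_eq, th, mul_add, ← tsum_mul_left]
  have : ∀ n : ℕ, T i * ((-1 : LX) ^ (n + 1) *
      qX ^ ((n + 1) * (n + 2) / 2 + (n + 1) * i) * (Cx ^ (n + 1) + Cx⁻¹ ^ (n + 1)))
      = T (i + (n + 1)) * y (n + 1) := by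
    intro n
    rw [T_add, T, y, T, pow_add _ ((n + 1) * (n + 2) / 2), mul_comm i]
    ring
  simp_rw [this]
  ring

lemma θ_rec (i : ℕ) : y 1 * θ (i + 1) = θ i + θ (i + 2) + T (i + 2) - T i := by
  have h1 : y 1 * Th (i + 1) = 2 * T (i + 1) * y 1 + ∑' n, T (i + (n + 1 + 1)) * y (n + 1 + 1)
      + Th (i + 2) := by
    have s0 : Summable fun n => T (i + (n + 1 + 1)) * y (n + 1 + 1) :=
      (summable_nat_add_iff 2).2 (sumT i)
    rw [Th_eq, mul_add, ← tsum_mul_left, add_assoc, Th, ← s0.tsum_add (sumT (i + 2))]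
    congr 1
    · ring
    · refine tsum_congr fun n => ?_
      rw [show i + 1 + (n + 1) = i + 2 + n by ring, show i + (n + 1 + 1) = i + 2 + n by ring]
      linear_combination T (i + 2 + n) * y_rec n
  have h2 : Th i = 2 * T i + T (i + 1) * y 1 + ∑' n, T (i + (n + 1 + 1)) * y (n + 1 + 1) := by
    rw [Th_eq, ((summable_nat_add_iff 1).2 (sumT i)).tsum_eq_zero_add]
    ring
  rw [θ_eq', θ_eq', θ_eq', mul_sub, h1, h2]
  ring

lemma Od_th (i : ℕ) : Od i (th i - 1) := by
  rw [th, add_sub_cancel_left]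
  refine Od_tsum fun n => ?_
  refine ((Od_neg_one_pow _).mul (Od_pow _)).mul' (Od_y (n + 1)) ?_
  push_cast
  have : (0 : ℤ) ≤ ((n : ℤ) + 1) * (n + 2) / 2 := by positivity
  nlinarith [Int.natCast_nonneg n, Int.natCast_nonneg i]

lemma Od_th0 (i : ℕ) : Od 0 (th i) := by
  have := ((Od_th i).mono (Int.natCast_nonneg i)).add Od_one
  simpa using this

lemma Od_θ (i : ℕ) : Od ((i * (i + 1) / 2 : ℕ) : ℤ) (θ i) := by
  rw [θ_eq]
  exact (Od_T i).mul' (Od_th0 i) (by simp)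

/-- falling products -/
def P (e : ℤ) (n : ℕ) : LX := ∏ j ∈ Finset.range n, (qX ^ (e - j) - 1)

lemma P_succ (e : ℤ) (n : ℕ) : P e (n + 1) = P e n * (qX ^ (e - n) - 1) :=
  Finset.prod_range_succ _ _

lemma P_succ' (e : ℤ) (n : ℕ) : P e (n + 1) = (qX ^ e - 1) * P (e - 1) n := by
  unfold P
  rw [Finset.prod_range_succ', mul_comm]
  simp only [Nat.cast_zero, sub_zero, Nat.cast_add, Nat.cast_one]
  congr 1
  refine Finset.prod_congr rfl fun j _ => ?_
  rw [show e - (j + 1 : ℤ) = e - 1 - j by ring]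

lemma v_zpow_sub_one {m : ℤ} (hm : 0 < m) :
    Valued.v (qX ^ m - 1) = (1 : WithZero (Multiplicative ℤ)) := by
  rw [Valuation.map_sub_swap]
  exact v_one_sub ((Od_zpow m).mono (by omega))

lemma P_ne (e : ℤ) (n : ℕ) (h : (n : ℤ) ≤ e) : P e n ≠ 0 := by
  refine Finset.prod_ne_zero_iff.2 fun j hj => ne_of_v (v_zpow_sub_one ?_)
  simp at hj; omega

/-- Gaussian binomial in LX -/
def B (i : ℤ) (k : ℕ) : LX := qX ^ ((k : ℤ) * (k - i)) * P (k + i) (2 * k) * (P (2 * k) (2 * k))⁻¹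

lemma B_zero {i : ℤ} {k : ℕ} (h1 : i < k) (h2 : -(k : ℤ) ≤ i) : B i k = 0 := by
  have : P (k + i) (2 * k) = 0 := by
    refine Finset.prod_eq_zero (i := (k + i).toNat) (by simp; omega) ?_
    rw [Int.toNat_of_nonneg (by omega)]; simp
  simp [B, this]

lemma B_self (k : ℕ) : B k k = 1 := by
  have := P_ne (2 * k) (2 * k) (by push_cast; omega)
  rw [B, show (k + k : ℤ) = 2 * k by ring]
  simp [this]

lemma B_step (i : ℤ) (k : ℕ) : B (i + 1) k * (qX ^ (i + 1 - k) - 1) =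
    qX ^ (-(k : ℤ)) * (qX ^ (i + k + 1) - 1) * B i k := by
  have h := P_succ (k + (i + 1)) (2 * k)
  rw [P_succ'] at h
  rw [show (k : ℤ) + (i + 1) - 1 = k + i by ring,
    show (k : ℤ) + (i + 1) - ((2 * k : ℕ) : ℤ) = i + 1 - k by push_cast; ring,
    show (k : ℤ) + (i + 1) = i + k + 1 by ring] at h
  rw [B, B, show (k : ℤ) * (k - (i + 1)) = -k + k * (k - i) by ring, zpow_add₀ qX_ne,
    show (k : ℤ) + (i + 1) = i + k + 1 by ring]
  linear_combination (-(qX ^ (-(k : ℤ)) * qX ^ ((k : ℤ) * (k - i)) * (P (2 * k) (2 * k))⁻¹)) * h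

lemma B_rec (i : ℤ) (k : ℕ) : B (i + 1) (k + 1) + B (i - 1) (k + 1) -
    (qX ^ ((k : ℤ) + 1) + qX ^ (-((k : ℤ) + 1))) * B i (k + 1) = B i k := by
  have hq := qX_ne
  have hD := P_ne (2 * k) (2 * k) (by push_cast; omega)
  have hD' := P_ne (2 * (k + 1 : ℕ)) (2 * (k + 1)) (by push_cast; omega)
  have eD : P (2 * (k + 1 : ℕ)) (2 * (k + 1)) =
      (qX ^ (2 * (k : ℤ) + 2) - 1) * ((qX ^ (2 * (k : ℤ) + 1) - 1) * P (2 * k) (2 * k)) := by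
    rw [show 2 * (k + 1) = 2 * k + 1 + 1 by ring, P_succ', P_succ']
    congr 2 <;> push_cast <;> ring_nf
  have e1 : P ((k + 1 : ℕ) + (i + 1)) (2 * (k + 1)) =
      (qX ^ (i + k + 2) - 1) * ((qX ^ (i + k + 1) - 1) * P (k + i) (2 * k)) := by
    rw [show 2 * (k + 1) = 2 * k + 1 + 1 by ring, P_succ', P_succ']
    congr 2 <;> push_cast <;> ring_nf
  have e2 : P ((k + 1 : ℕ) + i) (2 * (k + 1)) =
      (qX ^ (i + k + 1) - 1) * (P (k + i) (2 * k) * (qX ^ (i - k) - 1)) := by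
    rw [show 2 * (k + 1) = 2 * k + 1 + 1 by ring, P_succ', P_succ]
    congr 2 <;> push_cast <;> ring_nf
  have e3 : P ((k + 1 : ℕ) + (i - 1)) (2 * (k + 1)) =
      (P (k + i) (2 * k) * (qX ^ (i - k) - 1)) * (qX ^ (i - k - 1) - 1) := by
    rw [show 2 * (k + 1) = 2 * k + 1 + 1 by ring, P_succ, P_succ]
    congr 2 <;> push_cast <;> ring_nf
  rw [eD] at hD'
  have hD1 := left_ne_zero_of_mul hD'
  have hD2 := left_ne_zero_of_mul (right_ne_zero_of_mul hD')
  have x1 : qX ^ (((k + 1 : ℕ) : ℤ) * ((k + 1 : ℕ) - (i + 1))) =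
      qX ^ ((k : ℤ) * (k - i)) * (qX ^ (k : ℤ) * (qX ^ i)⁻¹) := by
    rw [← zpow_neg, ← zpow_add₀ hq, ← zpow_add₀ hq]; congr 1; push_cast; ring
  have x2 : qX ^ (((k + 1 : ℕ) : ℤ) * ((k + 1 : ℕ) - i)) =
      qX ^ ((k : ℤ) * (k - i)) * (qX ^ (k : ℤ) * (qX ^ i)⁻¹ * (qX ^ (k : ℤ) * qX)) := by
    rw [← zpow_neg, ← zpow_add_one₀ hq, ← zpow_add₀ hq, ← zpow_add₀ hq, ← zpow_add₀ hq]
    congr 1; push_cast; ring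
  have x3 : qX ^ (((k + 1 : ℕ) : ℤ) * ((k + 1 : ℕ) - (i - 1))) =
      qX ^ ((k : ℤ) * (k - i)) * (qX ^ (k : ℤ) * (qX ^ i)⁻¹ * (qX ^ (k : ℤ) * qX) *
        (qX ^ (k : ℤ) * qX)) := by
    rw [← zpow_neg, ← zpow_add_one₀ hq, ← zpow_add₀ hq, ← zpow_add₀ hq, ← zpow_add₀ hq,
      ← zpow_add₀ hq]
    congr 1; push_cast; ring
  simp only [B, eD, e1, e2, e3, x1, x2, x3]
  rw [show 2 * (k : ℤ) + 2 = k + k + 1 + 1 by ring, show 2 * (k : ℤ) + 1 = k + k + 1 by ring,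
    show i + (k : ℤ) + 2 = i + k + 1 + 1 by ring] at *
  simp only [zpow_add₀ hq, zpow_sub₀ hq, zpow_neg, zpow_one] at *
  have ha : qX ^ i ≠ 0 := zpow_ne_zero _ hq
  have hb : qX ^ (k : ℤ) ≠ 0 := zpow_ne_zero _ hq
  generalize qX ^ ((k : ℤ) * (k - i)) = Z at *
  generalize qX ^ i = α at *
  generalize qX ^ (k : ℤ) = β at *
  generalize P (k + i) (2 * k) = p at *
  generalize P (2 * k) (2 * k) = d at *
  have hD3 : β ^ 2 * qX ^ 2 - 1 ≠ 0 := by convert hD1 using 1; ring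
  have hD4 : β ^ 2 * qX - 1 ≠ 0 := by convert hD2 using 1; ring
  clear hD1 hD2 hD' eD e1 e2 e3 x1 x2 x3
  field_simp
  ring

/-- normalized binomials -/
def c (k m : ℕ) : LX := B (k + m) k * qX ^ (k * m)

lemma c_zero (k : ℕ) : c k 0 = 1 := by simp [c, B_self]

lemma v_pow (m : ℕ) : Valued.v (1 - qX ^ (m + 1)) = (1 : WithZero (Multiplicative ℤ)) :=
  v_one_sub ((Od_pow (m + 1)).mono (by omega))

lemma c_succ (k m : ℕ) : c k (m + 1) =
    (1 - qX ^ (2 * k + m + 1)) * c k m * (1 - qX ^ (m + 1))⁻¹ := by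
  have hne := ne_of_v (v_pow m)
  have h := B_step (k + m) k
  rw [show (k : ℤ) + m + 1 - k = (m + 1 : ℕ) by push_cast; ring,
    show (k : ℤ) + m + k + 1 = (2 * k + m + 1 : ℕ) by push_cast; ring, zpow_natCast,
    zpow_natCast, zpow_neg, zpow_natCast] at h
  rw [eq_mul_inv_iff_mul_eq₀ hne]
  unfold c
  push_cast
  rw [← add_assoc, show k * (m + 1) = k * m + k by ring, pow_add]
  have hk : (qX ^ k)⁻¹ * qX ^ k = 1 := inv_mul_cancel₀ (pow_ne_zero _ qX_ne)
  linear_combination (-(qX ^ (k * m) * qX ^ k)) * h +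
    (1 - qX ^ (2 * k + m + 1)) * B (k + m) k * qX ^ (k * m) * hk

lemma Od_c (k m : ℕ) : Od 0 (c k m) := by
  induction m with
  | zero => rw [c_zero]; exact Od_one
  | succ m ih =>
    rw [c_succ]
    exact ((Od_of_v (v_pow (2 * k + m))).mul ih).mul' (Od_inv_of_v (v_pow m)) (by simp)

lemma B_eq_c (k m : ℕ) : B (k + m) k = c k m * qX ^ (-((k : ℤ) * m)) := by
  have : qX ^ (k * m) ≠ 0 := pow_ne_zero _ qX_ne
  rw [c, zpow_neg, ← Nat.cast_mul, zpow_natCast]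
  field_simp

lemma Od_B (i k : ℕ) : Od ((k : ℤ) * (k - i)) (B i k) := by
  rcases lt_or_ge i k with h | h
  · rw [B_zero (by omega) (by omega)]; exact Od_zero _
  · obtain ⟨m, rfl⟩ := Nat.exists_eq_add_of_le h
    push_cast
    rw [B_eq_c]
    exact (Od_c k m).mul' (Od_zpow _) (by linarith)

/-- `1/(q)_m` -/
def ee : ℕ → LX
  | 0 => 1
  | m + 1 => ee m * (1 - qX ^ (m + 1))⁻¹

lemma Od_ee (m : ℕ) : Od 0 (ee m) := by
  induction m with
  | zero => exact Od_one
  | succ m ih => exact ih.mul' (Od_inv_of_v (v_pow m)) (by simp)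

lemma Od_c_sub (k m : ℕ) : Od k (c k m - ee m) := by
  induction m with
  | zero => rw [c_zero, ee, sub_self]; exact Od_zero _
  | succ m ih =>
    rw [c_succ, ee, ← sub_mul]
    refine Od.mul' (m := k) ?_ (Od_inv_of_v (v_pow m)) (by simp)
    have : (1 - qX ^ (2 * k + m + 1)) * c k m - ee m =
      (c k m - ee m) - qX ^ (2 * k + m + 1) * c k m := by ring
    rw [this]
    exact ih.sub ((Od_pow _).mul' (Od_c k m) (by push_cast; omega))

/-- embedding as a ring hom -/
def liftH : LaurentSeries ℚ →+* LX where
  toFun := liftQ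
  map_zero' := by ext; simp [liftQ]
  map_one' := by ext; simp [liftQ, HahnSeries.coeff_one]
  map_add' f g := by ext; simp [liftQ]
  map_mul' f g := HahnSeries.map_mul (algebraMap ℚ (RatFunc ℚ) : ℚ →ₙ+* RatFunc ℚ)

lemma liftH_qq : liftH qq = qX := by
  ext n
  change algebraMap ℚ (RatFunc ℚ) (qq.coeff n) = _
  simp only [qq, qX, HahnSeries.coeff_single]; split_ifs <;> simp

lemma liftH_bq (i k : ℕ) : liftH (bq i k) = B i k := by
  simp only [bq, B, P, map_mul, map_inv₀, map_prod, map_zpow₀, map_sub, map_one, liftH_qq]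

lemma sumBX (k s : ℕ) {F : ℕ → LX} (h : ∀ i : ℕ, Od ((i * (i + 1) / 2 : ℕ) : ℤ) (F i)) :
    Summable fun i : ℕ => B ((i + s : ℕ) : ℤ) k * F i := by
  refine summable_nat _ ((s : ℤ) ^ 2) (fun i => (Od_B (i + s) k).mul (h i)) fun i => ?_
  rw [mul_add, tri2z]
  push_cast
  nlinarith [sq_nonneg ((i : ℤ) - k), sq_nonneg ((k : ℤ) - s)]

/-- the theta expansion of `σ̃` -/
def R (k : ℕ) : LX := ∑' i : ℕ, B i k * θ i

lemma sumR (k : ℕ) : Summable fun i : ℕ => B i k * θ i := by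
  simpa using sumBX k 0 Od_θ

lemma Od_tri_succ {i : ℕ} {F : LX} (h : Od (((i + 1) * (i + 1 + 1) / 2 : ℕ) : ℤ) F) :
    Od ((i * (i + 1) / 2 : ℕ) : ℤ) F := by
  refine h.mono ?_
  have h1 := tri2z i
  have h2 := tri2z (i + 1)
  push_cast at h1 h2 ⊢
  nlinarith

lemma T_succ (i : ℕ) : T (i + 1) = -(T i * qX ^ (i + 1)) := by
  rw [T_add, show T 1 = -qX by simp [T]; ring, pow_succ]; ring

/-- telescoping sequence -/
def H (k i : ℕ) : LX := T i * B ((i + 1 : ℕ) : ℤ) (k + 1) * (1 - qX ^ ((i : ℤ) - k))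

lemma H_zero (k : ℕ) : H k 0 = 0 := by
  rcases k with _ | k
  · simp [H]
  · rw [H, B_zero (by push_cast; omega) (by push_cast; omega)]; simp

lemma H_step (k i : ℕ) : H k (i + 1) - H k i =
    B ((i + 1 : ℕ) : ℤ) (k + 1) * (T (i + 2) - T i) := by
  have h := B_step ((i + 1 : ℕ) : ℤ) (k + 1)
  have hq := qX_ne
  unfold H
  rw [T_succ (i + 1), T_succ i]
  push_cast at h ⊢
  rw [show (i : ℤ) + 1 + 1 - (k + 1) = i + 1 - k by ring] at h
  have e1 : qX ^ (i + 1) * (qX ^ (-((k : ℤ) + 1))) = qX ^ ((i : ℤ) - k) := by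
    rw [← zpow_natCast, ← zpow_add₀ hq]; congr 1; push_cast; ring
  have e2 : qX ^ ((i : ℤ) - k) * qX ^ ((i : ℤ) + 1 + (k + 1) + 1) = qX ^ (i + 1) * qX ^ (i + 2) := by
    rw [← zpow_natCast, ← zpow_natCast, ← zpow_add₀ hq, ← zpow_add₀ hq]
    congr 1; push_cast; ring
  generalize B ((i : ℤ) + 1) (k + 1) = b at *
  generalize B ((i : ℤ) + 1 + 1) (k + 1) = b' at *
  linear_combination (T i * qX ^ (i + 1)) * h +
    (T i * b * (qX ^ ((i : ℤ) + 1 + (k + 1) + 1) - 1)) * e1 + T i * b * e2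

lemma sumH (k : ℕ) : Summable (H k) := by
  have h1 := sumBX (k + 1) 1 Od_T
  have h2 := (sumBX (k + 1) 1 (F := fun i => T i * qX ^ i) fun i =>
    (Od_T i).mul' (Od_pow i) (by omega)).mul_left (qX ^ (-(k : ℤ)))
  refine (h1.sub h2).congr fun i => ?_
  rw [H, sub_eq_add_neg (i : ℤ), zpow_add₀ qX_ne, zpow_natCast]
  ring

lemma tele (k : ℕ) : HasSum (fun i : ℕ => B ((i + 1 : ℕ) : ℤ) (k + 1) * (T (i + 2) - T i)) 0 := by
  have s1 : Summable fun i => H k (i + 1) := (summable_nat_add_iff 1).2 (sumH k)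
  have := s1.hasSum.sub (sumH k).hasSum
  rw [(sumH k).tsum_eq_zero_add, H_zero, zero_add, sub_self] at this
  refine this.congr_fun ?_
  intro i
  exact (H_step k i).symm

lemma R_rec (k : ℕ) : (y 1 - (qX ^ ((k : ℤ) + 1) + qX ^ (-((k : ℤ) + 1)))) * R (k + 1) = R k := by
  set cc := qX ^ ((k : ℤ) + 1) + qX ^ (-((k : ℤ) + 1)) with hcc
  have b0 : B ((0 : ℕ) : ℤ) (k + 1) = 0 := B_zero (by push_cast; omega) (by push_cast; omega)
  have b1 : B (((0 : ℕ) : ℤ) - 1) (k + 1) = 0 := B_zero (by push_cast; omega) (by push_cast; omega)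
  have s1 := sumBX (k + 1) 1 Od_θ
  have s2' : Summable fun i : ℕ => B (i : ℤ) (k + 1) * θ (i + 1) := by
    simpa using sumBX (k + 1) 0 (F := fun i => θ (i + 1)) fun i => Od_tri_succ (Od_θ (i + 1))
  have s2 : Summable fun i : ℕ => B ((i : ℤ) - 1) (k + 1) * θ i := by
    refine (summable_nat_add_iff 1).1 ?_
    simpa using s2'
  have s2'' : Summable fun i : ℕ => B ((i + 1 : ℕ) : ℤ) (k + 1) * θ (i + 1 + 1) :=
    (summable_nat_add_iff 1).2 s2'
  have e2 : ∑' i : ℕ, B ((i + 1 : ℕ) : ℤ) (k + 1) * θ (i + 1 + 1) =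
      ∑' i : ℕ, B ((i : ℤ) - 1) (k + 1) * θ i := by
    rw [s2.tsum_eq_zero_add, b1]
    have : ∀ i : ℕ, B (((i + 1 : ℕ) : ℤ) - 1) (k + 1) * θ (i + 1) =
      B (i : ℤ) (k + 1) * θ (i + 1) := by intro i; simp
    simp_rw [this]
    rw [s2'.tsum_eq_zero_add, b0]
    ring
  have e1 : y 1 * R (k + 1) = ∑' i : ℕ, B ((i + 1 : ℕ) : ℤ) (k + 1) * θ i +
      ∑' i : ℕ, B ((i : ℤ) - 1) (k + 1) * θ i := by
    rw [R, (sumR (k + 1)).tsum_eq_zero_add, b0, zero_mul, zero_add, ← tsum_mul_left, ← e2,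
      ← s1.tsum_add s2'', ← add_zero (∑' i, (_ + _)), ← (tele k).tsum_eq,
      ← (s1.add s2'').tsum_add (tele k).summable]
    refine tsum_congr fun i => ?_
    linear_combination B ((i + 1 : ℕ) : ℤ) (k + 1) * θ_rec i
  rw [sub_mul, e1, R, R, ← tsum_mul_left, ← s1.tsum_add s2,
    ← (s1.add s2).tsum_sub ((sumR (k + 1)).mul_left cc)]
  refine tsum_congr fun i => ?_
  have := B_rec i k
  push_cast
  rw [← hcc] at this
  linear_combination θ i * this

lemma sumQ (k : ℕ) : Summable fun m => c k m * T m * th (k + m) := by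
  refine summable_nat _ 0 (fun m => ((Od_c k m).mul (Od_T m)).mul (Od_th0 (k + m))) fun m => ?_
  have := tri_ge m
  omega

/-- normalized theta expansion -/
def Q (k : ℕ) : LX := ∑' m, c k m * T m * th (k + m)

lemma R_eq (k : ℕ) : R k = T k * Q k := by
  rw [R, ← (sumR k).sum_add_tsum_nat_add k, Finset.sum_eq_zero, zero_add, Q, ← tsum_mul_left]
  · refine tsum_congr fun m => ?_
    have h1 : qX ^ (-((k : ℤ) * m)) * qX ^ (k * m) = 1 := by
      rw [← zpow_natCast, ← zpow_add₀ qX_ne]; simp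
    rw [add_comm m k, θ_eq, T_add]
    push_cast
    rw [B_eq_c]
    linear_combination c k m * T k * T m * th (k + m) * h1
  · intro i hi
    rw [B_zero (by simpa using hi) (by omega), zero_mul]

/-- Euler sums -/
def A (j : ℕ) : LX := ∑' m, T m * qX ^ (j * m) * ee m

lemma sumA (j : ℕ) : Summable fun m => T m * qX ^ (j * m) * ee m := by
  refine summable_nat _ 0 (fun m => ((Od_T m).mul (Od_pow (j * m))).mul (Od_ee m)) fun m => ?_
  have := tri_ge m
  have : (0 : ℤ) ≤ ((j * m : ℕ) : ℤ) := by positivity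
  omega

lemma A_eq (j : ℕ) : A j = 1 + ∑' m, T (m + 1) * qX ^ (j * (m + 1)) * ee (m + 1) := by
  rw [A, (sumA j).tsum_eq_zero_add]
  simp [T, ee]

lemma Od_A (j : ℕ) : Od j (A j - 1) := by
  rw [A_eq, add_sub_cancel_left]
  refine Od_tsum fun m => ?_
  refine ((Od_T _).mul (Od_pow _)).mul' (Od_ee _) ?_
  have : (0 : ℤ) ≤ (((m + 1) * (m + 1 + 1) / 2 : ℕ) : ℤ) := by positivity
  have h : ((j * (m + 1) : ℕ) : ℤ) = j * m + j := by push_cast; ring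
  have : (0 : ℤ) ≤ j * m := by positivity
  omega

lemma A_rec (j : ℕ) : A j = (1 - qX ^ (j + 1)) * A (j + 1) := by
  have s1 := (summable_nat_add_iff 1).2 (sumA j)
  have s2 := (summable_nat_add_iff 1).2 (sumA (j + 1))
  have h : A j - A (j + 1) = -qX ^ (j + 1) * A (j + 1) := by
    conv_lhs => rw [A_eq j, A_eq (j + 1), add_sub_add_left_eq_sub, ← s1.tsum_sub s2]
    rw [A, ← tsum_mul_left]
    refine tsum_congr fun m => ?_
    have hne := mul_inv_cancel₀ (ne_of_v (v_pow m))
    rw [T_succ, ee, show (j + 1) * (m + 1) = j * (m + 1) + (m + 1) by ring, pow_add qX (j * (m + 1))]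
    have e : qX ^ (m + 1) * qX ^ (j * (m + 1)) = qX ^ (j + 1) * qX ^ ((j + 1) * m) := by
      rw [← pow_add, ← pow_add]; congr 1; ring
    linear_combination (-(T m * qX ^ (m + 1) * qX ^ (j * (m + 1)) * ee m)) * hne - T m * ee m * e
  linear_combination h

lemma A_prod (N : ℕ) : A 0 = (∏ j ∈ Finset.range N, (1 - qX ^ (j + 1))) * A N := by
  induction N with
  | zero => simp
  | succ N ih => rw [ih, Finset.prod_range_succ, A_rec N]; ring

lemma eq_zero_of_Od {F : LX} (h : ∀ n : ℕ, Od n F) : F = 0 := by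
  ext w
  exact Od_iff.1 (h (w + 1).toNat) w (by omega)

lemma P1 : ∀ n : ℕ, Od n (∏ i ∈ Finset.range n, (1 - qX ^ (i + 1)) - ∏' i : ℕ, (1 - qX ^ (i + 1))) :=
  (hasProd_nat (fun n => Od_of_v (v_pow n)) fun n => by
    rw [sub_sub_cancel_left]; exact ((Od_pow (n + 1)).mono (by omega)).neg).2

lemma P2 : ∀ n : ℕ, Od n (∏ i ∈ Finset.range n, (1 - Cx * qX ^ i) - ∏' i : ℕ, (1 - Cx * qX ^ i)) := by
  have h : ∀ n : ℕ, Od n (Cx * qX ^ n) := fun n => (Od_of_v v_Cx).mul' (Od_pow n) (by simp)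
  exact (hasProd_nat (fun n => Od_one.sub ((h n).mono (by omega))) fun n => by
    rw [sub_sub_cancel_left]; exact (h n).neg).2

lemma P3 : ∀ n : ℕ, Od n (∏ i ∈ Finset.range n, (1 - Cx⁻¹ * qX ^ (i + 1)) -
    ∏' i : ℕ, (1 - Cx⁻¹ * qX ^ (i + 1))) := by
  have h : ∀ n : ℕ, Od n (Cx⁻¹ * qX ^ (n + 1)) := fun n =>
    (Od_inv_of_v v_Cx).mul' (Od_pow (n + 1)) (by push_cast; omega)
  exact (hasProd_nat (fun n => Od_one.sub ((h n).mono (by omega))) fun n => by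
    rw [sub_sub_cancel_left]; exact (h n).neg).2

lemma Od0_of {F G : LX} {n : ℕ} (h : Od n (F - G)) (hF : Od 0 F) : Od 0 G := by
  have := hF.sub (h.mono (Int.natCast_nonneg n))
  simpa using this

lemma A0 : A 0 = ∏' i : ℕ, (1 - qX ^ (i + 1)) := by
  rw [← sub_eq_zero]
  refine eq_zero_of_Od fun n => ?_
  have h0 : Od 0 (∏ i ∈ Finset.range n, (1 - qX ^ (i + 1))) :=
    Od_prod _ fun i _ => Od_of_v (v_pow i)
  have : A 0 - ∏' i : ℕ, (1 - qX ^ (i + 1)) =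
    (∏ i ∈ Finset.range n, (1 - qX ^ (i + 1))) * (A n - 1) +
    (∏ i ∈ Finset.range n, (1 - qX ^ (i + 1)) - ∏' i : ℕ, (1 - qX ^ (i + 1))) := by
    rw [A_prod n]; ring
  rw [this]
  exact (h0.mul' (Od_A n) (by simp)).add (P1 n)

lemma Od_Q (k : ℕ) : Od k (Q k - A 0) := by
  rw [Q, A, ← (sumQ k).tsum_sub (sumA 0)]
  refine Od_tsum fun m => ?_
  have : c k m * T m * th (k + m) - T m * qX ^ (0 * m) * ee m =
    T m * (c k m * (th (k + m) - 1) + (c k m - ee m)) := by simp; ring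
  rw [this]
  refine ((Od_T m).mono (Int.natCast_nonneg _)).mul' (n := k) (Od.add ?_ (Od_c_sub k m)) (by simp)
  exact (Od_c k m).mul' (Od_th _) (by push_cast; omega)

/-- the k-independent quantity -/
def E (k : ℕ) : LX := Q k * pochL Cx (k + 1) * pochL (qX * Cx⁻¹) k

lemma E_succ (k : ℕ) : E (k + 1) = E k := by
  have h := R_rec k
  rw [R_eq, R_eq, T_succ] at h
  have hq := qX_ne
  have hx : Cx * Cx⁻¹ = 1 := mul_inv_cancel₀ Cx_ne
  have hqi : qX ^ (k + 1) * qX ^ (-((k : ℤ) + 1)) = 1 := by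
    rw [← zpow_natCast, ← zpow_add₀ hq]; simp
  have hz : qX ^ ((k : ℤ) + 1) = qX ^ (k + 1) := by exact_mod_cast zpow_natCast qX (k + 1)
  rw [hz] at h
  have h' : Q k = (1 - Cx * qX ^ (k + 1)) * (1 - qX * Cx⁻¹ * qX ^ k) * Q (k + 1) := by
    apply mul_left_cancel₀ (T_ne k)
    rw [← h, y]
    linear_combination T k * Q (k + 1) * hqi - T k * Q (k + 1) * qX ^ (k + 1) * qX ^ (k + 1) * hx
  have e1 : pochL Cx (k + 1 + 1) = pochL Cx (k + 1) * (1 - Cx * qX ^ (k + 1)) :=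
    Finset.prod_range_succ _ _
  have e2 : pochL (qX * Cx⁻¹) (k + 1) = pochL (qX * Cx⁻¹) k * (1 - qX * Cx⁻¹ * qX ^ k) :=
    Finset.prod_range_succ _ _
  rw [E, E, h', e1, e2]
  ring

lemma E_const (k : ℕ) : E k = E 0 := by
  induction k with
  | zero => rfl
  | succ k ih => rw [E_succ, ih]

lemma E_eq (k : ℕ) : E k = pochInf := by
  rw [E_const, ← sub_eq_zero]
  refine eq_zero_of_Od fun n => ?_
  rw [← E_const n, E, pochInf, ← A0]
  have hQ := Od_Q n
  have h2 : Od n (pochL Cx (n + 1) - ∏' i : ℕ, (1 - Cx * qX ^ i)) :=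
    (P2 (n + 1)).mono (by push_cast; omega)
  have h3 : Od n (pochL (qX * Cx⁻¹) n - ∏' i : ℕ, (1 - Cx⁻¹ * qX ^ (i + 1))) := by
    have e : pochL (qX * Cx⁻¹) n = ∏ i ∈ Finset.range n, (1 - Cx⁻¹ * qX ^ (i + 1)) :=
      Finset.prod_congr rfl fun i _ => by ring
    rw [e]; exact P3 n
  have a0 : Od 0 (A 0) := by
    have := ((Od_A 0).mono (by simp)).add Od_one
    simpa using this
  have q0 : Od 0 (Q n) := by
    have := (hQ.mono (Int.natCast_nonneg n)).add a0
    simpa using this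
  have p20 : Od 0 (pochL Cx (n + 1)) := Od_prod _ fun i _ =>
    Od_one.sub ((Od_of_v v_Cx).mul' (Od_pow i) (by omega))
  have p30 : Od 0 (pochL (qX * Cx⁻¹) n) := Od_prod _ fun i _ =>
    Od_one.sub (((Od_of_v (by simp) : Od 0 1).mul ((Od_zpow 1).mul (Od_inv_of_v v_Cx))).mul'
      (Od_pow i) (l := 0) (by omega) |> fun h => by simpa using h)
  have t20 := Od0_of h2 p20
  have : Q n * pochL Cx (n + 1) * pochL (qX * Cx⁻¹) n - A 0 * (∏' i : ℕ, (1 - Cx * qX ^ i)) *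
      (∏' i : ℕ, (1 - Cx⁻¹ * qX ^ (i + 1))) =
      (Q n - A 0) * (pochL Cx (n + 1) * pochL (qX * Cx⁻¹) n) +
      (pochL Cx (n + 1) - ∏' i : ℕ, (1 - Cx * qX ^ i)) * (A 0 * pochL (qX * Cx⁻¹) n) +
      (pochL (qX * Cx⁻¹) n - ∏' i : ℕ, (1 - Cx⁻¹ * qX ^ (i + 1))) *
        (A 0 * ∏' i : ℕ, (1 - Cx * qX ^ i)) := by ring
  rw [this]
  exact ((hQ.mul' (p20.mul p30) (by simp)).add (h2.mul' (a0.mul p30) (by simp))).add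
    (h3.mul' (a0.mul t20) (by simp))

lemma not_Od {F : LX} (h : Valued.v F = (1 : WithZero (Multiplicative ℤ))) : ¬ Od 1 F := by
  rw [Od, h, not_le, ← exp_zero]
  exact exp_lt_exp.2 (by omega)

lemma v_q_Cx (i : ℕ) : Valued.v (1 - Cx * qX ^ i) = (1 : WithZero (Multiplicative ℤ)) := by
  rcases i with _ | i
  · simpa using v_one_sub_Cx
  · exact v_one_sub ((Od_of_v v_Cx).mul' (Od_pow (i + 1)) (by push_cast; omega))

lemma v_q_Cxi (i : ℕ) : Valued.v (1 - Cx⁻¹ * qX ^ (i + 1)) = (1 : WithZero (Multiplicative ℤ)) :=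
  v_one_sub ((Od_inv_of_v v_Cx).mul' (Od_pow (i + 1)) (by push_cast; omega))

lemma pochInf_ne : pochInf ≠ 0 := by
  refine mul_ne_zero (mul_ne_zero ?_ ?_) ?_
  · intro h
    have := P1 1
    rw [h, sub_zero, Finset.prod_range_one] at this
    exact not_Od (v_pow 0) this
  · intro h
    have := P2 1
    rw [h, sub_zero, Finset.prod_range_one] at this
    exact not_Od (v_q_Cx 0) this
  · intro h
    have := P3 1
    rw [h, sub_zero, Finset.prod_range_one] at this
    exact not_Od (v_q_Cxi 0) this

lemma R_σ (k : ℕ) : R k = pochInf * σt k := by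
  have h1 : pochL Cx (k + 1) ≠ 0 := Finset.prod_ne_zero_iff.2 fun i _ => ne_of_v (v_q_Cx i)
  have h2 : pochL (qX * Cx⁻¹) k ≠ 0 := Finset.prod_ne_zero_iff.2 fun i _ => by
    have := ne_of_v (v_q_Cxi i)
    convert this using 1; ring
  have hs : σt k = T k * (pochL Cx (k + 1) * pochL (qX * Cx⁻¹) k)⁻¹ := rfl
  rw [R_eq, ← E_eq k, E, hs]
  generalize pochL (qX * Cx⁻¹) k = u at *
  field_simp

lemma Od_a {a : ℕ → LaurentSeries ℚ} {C : ℤ} (h : LBC a C) (k : ℕ) :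
    Od (C + k + 1 - ((k * (k + 1) / 2 : ℕ) : ℤ)) (liftQ (a k)) := by
  refine Od_iff.2 fun w hw => ?_
  have : (a k).coeff w = 0 := by
    refine h k w ?_
    have := tri2z k
    nlinarith
  show algebraMap ℚ (RatFunc ℚ) ((a k).coeff w) = 0
  rw [this, map_zero]

end IHS

/-!
STATEMENT 7: Let (a_{−k−1})_{k≥0} be a sequence in ℚ((q)) satisfying the lower
bound condition, and set f_i = Σ_{k=0}^{i} binom[k+i, 2k]·a_{−k−1} ∈ ℚ((q)).
Then in ℚ(x)((q)) the families (a_{−k−1}·σ̃_{−k−1})_{k≥0} and (f_i·θ_i(x))_{i≥0}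
are summable and
Σ_{k=0}^{∞} a_{−k−1}·σ̃_{−k−1} = ((q,x,qx⁻¹;q)_∞)⁻¹ · Σ_{i=0}^{∞} f_i·θ_i(x).
-/

theorem inverted_Habiro_series_theta_formula
    (a : ℕ → LaurentSeries ℚ) (C : ℤ) (h : LBC a C)
    (f : ℕ → LaurentSeries ℚ)
    (hf : ∀ i : ℕ, f i = ∑ k ∈ Finset.range (i + 1), bq i k * a k) :
    Summable (fun k : ℕ => liftQ (a k) * σt k) ∧
    Summable (fun i : ℕ => liftQ (f i) * θ i) ∧
    ∑' k : ℕ, liftQ (a k) * σt k = pochInf⁻¹ * ∑' i : ℕ, liftQ (f i) * θ i := by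
  have hsum : Summable (fun p : ℕ × ℕ => liftQ (a p.1) * (IHS.B p.2 p.1 * θ p.2)) := by
    refine IHS.summable_prod _ (-2 * C - 2)
      (fun p => (IHS.Od_a h p.1).mul ((IHS.Od_B p.2 p.1).mul (IHS.Od_θ p.2))) fun p => ?_
    have h1 := IHS.tri2z p.1
    have h2 := IHS.tri2z p.2
    nlinarith [sq_nonneg ((p.1 : ℤ) - p.2)]
  have hk : ∀ k : ℕ, ∑' i : ℕ, liftQ (a k) * (IHS.B i k * θ i) =
      pochInf * (liftQ (a k) * σt k) := by
    intro k
    rw [tsum_mul_left, ← IHS.R, IHS.R_σ]; ring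
  have hi : ∀ i : ℕ, ∑' k : ℕ, liftQ (a k) * (IHS.B i k * θ i) = liftQ (f i) * θ i := by
    intro i
    rw [tsum_eq_sum (s := Finset.range (i + 1)), hf]
    · change _ = IHS.liftH _ * _
      rw [map_sum, Finset.sum_mul]
      refine Finset.sum_congr rfl fun k _ => ?_
      rw [map_mul, IHS.liftH_bq]
      change _ = _ * liftQ (a k) * _
      ring
    · intro k hk
      rw [IHS.B_zero (by simp at hk; omega) (by omega)]; simp
  have hne := IHS.pochInf_ne
  have S1 : Summable (fun k : ℕ => liftQ (a k) * σt k) := by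
    have := hsum.prod
    simp only [hk] at this
    exact (summable_mul_left_iff hne).1 this
  have S2 : Summable (fun i : ℕ => liftQ (f i) * θ i) := by
    have := hsum.prod_symm.prod
    simpa only [Prod.swap, hi] using this
  refine ⟨S1, S2, ?_⟩
  have hc := Summable.tsum_comm (f := fun k i : ℕ => liftQ (a k) * (IHS.B i k * θ i)) hsum
  simp only [hk, hi] at hc
  rw [hc, tsum_mul_left, inv_mul_cancel_left₀ hne]
end
end

section
/- For every integer i ≥ 0, the identity Σ_{k=i}^{∞} (−1)^{k+i}·binom[2k, k−i]·([2i+1]/[k+i+1])·σ̃_{−k−1} = θ_i(x)·((q,x,qx⁻¹;q)_∞)⁻¹ holds in ℚ(x)((q)); here the coefficient (−1)^{k+i}·binom[2k,k−i]·[2i+1]/[k+i+1] lies in the subfield ℚ(q) and is identified with its Laurent expansion in q, and the family on the left is summable (its q-orders tend to +∞). -/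
noncomputable section

/-- The coefficient `(−1)^{k+i}·binom[2k,k−i]·[2i+1]/[k+i+1]`, an element of the
subfield `ℚ(q)`, written via `q = v²`:
`(−1)^{k+i} q^{(k−i)(1−k−i)/2} ∏_{j=0}^{k−i−1}(q^{2k−j}−1)/∏_{j=0}^{k−i−1}(q^{k−i−j}−1)
· (q^{2i+1}−1)/(q^{k+i+1}−1)` (and `0` for `k < i`), identified with its Laurent
expansion in `q` inside `ℚ(x)((q))`. -/
def coefA (i k : ℕ) : LX :=
  if k < i then 0
  else (-1 : LX) ^ (k + i) * qX ^ ((((k : ℤ) - i) * (1 - ((k : ℤ) + i))) / 2) *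
    (∏ j ∈ Finset.range (k - i), (qX ^ ((2 * (k : ℤ)) - j) - 1)) *
    (∏ j ∈ Finset.range (k - i), (qX ^ (((k : ℤ) - i) - j) - 1))⁻¹ *
    (qX ^ (2 * i + 1) - 1) * (qX ^ (k + i + 1) - 1)⁻¹

/-!
STATEMENT 8: For every integer i ≥ 0, the identity
Σ_{k=i}^{∞} (−1)^{k+i}·binom[2k, k−i]·([2i+1]/[k+i+1])·σ̃_{−k−1}
  = θ_i(x)·((q,x,qx⁻¹;q)_∞)⁻¹
holds in ℚ(x)((q)), the family on the left being summable.
-/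


open Filter Topology WithZero

namespace TI

abbrev vv : Valuation LX ℤᵐ⁰ := Valued.v

lemma v_q : vv qX = exp (-1 : ℤ) := LaurentSeries.valuation_single_zpow (RatFunc ℚ) 1

lemma v_q_lt : vv qX < 1 := by rw [v_q, ← exp_zero]; exact exp_lt_exp.2 (by norm_num)

lemma q_ne : qX ≠ 0 := by
  intro h; have := v_q; rw [h, map_zero] at this; exact exp_ne_zero this.symm

lemma v_q_le : vv qX ≤ 1 := v_q_lt.le

lemma v_qpow_le (n : ℕ) : vv qX ^ n ≤ 1 := pow_le_one' v_q_le n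

lemma v_C_le (r : RatFunc ℚ) : vv (HahnSeries.C r : LX) ≤ 1 := by
  rw [← exp_zero, ← neg_zero, LaurentSeries.valuation_le_iff_coeff_lt_eq_zero]
  intro n hn
  simp [HahnSeries.C_apply, HahnSeries.coeff_single_of_ne hn.ne]

lemma v_C (r : RatFunc ℚ) (hr : r ≠ 0) : vv (HahnSeries.C r : LX) = 1 := by
  apply le_antisymm (v_C_le r)
  have h1 := v_C_le r⁻¹
  have h2 : vv (HahnSeries.C r : LX) * vv (HahnSeries.C r⁻¹ : LX) = 1 := by
    rw [← map_mul, ← map_mul, mul_inv_cancel₀ hr, map_one, map_one]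
  calc (1 : ℤᵐ⁰) = vv (HahnSeries.C r : LX) * vv (HahnSeries.C r⁻¹ : LX) := h2.symm
    _ ≤ vv (HahnSeries.C r : LX) * 1 := by gcongr
    _ = _ := mul_one _

lemma v_x : vv Cx = 1 := v_C _ RatFunc.X_ne_zero

lemma x_ne : Cx ≠ 0 := by
  intro h; have := v_x; rw [h, map_zero] at this; exact zero_ne_one this

lemma v_y : vv Cx⁻¹ = 1 := by rw [map_inv₀, v_x, inv_one]

lemma v_one_sub_x : vv (1 - Cx) = 1 := by
  have : (1 - Cx : LX) = HahnSeries.C (1 - RatFunc.X) := by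
    rw [map_sub, map_one]; rfl
  rw [this]
  apply v_C
  intro h
  have h1 : (RatFunc.X : RatFunc ℚ) = 1 := (sub_eq_zero.1 h).symm
  have h2 : algebraMap (Polynomial ℚ) (RatFunc ℚ) Polynomial.X = algebraMap _ _ 1 := by
    rw [RatFunc.algebraMap_X, h1, map_one]
  have h3 := RatFunc.algebraMap_injective ℚ h2
  exact Polynomial.X_ne_C (1 : ℚ) (by simpa using h3)

lemma nhds_zero_mem {s : Set LX} (hs : s ∈ 𝓝 (0 : LX)) : ∃ n : ℕ, {y | vv y ≤ vv qX ^ n} ⊆ s := by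
  obtain ⟨γ, hγ⟩ := Valued.mem_nhds_zero.1 hs
  have : ∃ n : ℕ, (Valued.v.restrict qX) ^ n < γ.1 := by
    apply exists_pow_lt₀
    exact Valued.v.restrict_lt_one_iff.2 v_q_lt
  obtain ⟨n, hn⟩ := this
  refine ⟨n, fun y hy => hγ ?_⟩
  refine lt_of_le_of_lt ?_ hn
  rw [← map_pow]
  apply Valued.v.restrict_le_iff.2
  rw [map_pow]; exact hy

lemma isOpen_b (n : ℕ) : IsOpen {y : LX | vv y ≤ vv qX ^ n} := by
  have := Valued.isOpen_closedBall LX (r := Valued.v.restrict (qX ^ n)) (by simp [q_ne])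
  simpa only [Valued.v.restrict_le_iff, map_pow vv] using this

lemma isClosed_b (n : ℕ) : IsClosed {y : LX | vv y ≤ vv qX ^ n} := by
  have := Valued.isClosed_closedBall LX (r := Valued.v.restrict (qX ^ n))
  simpa only [Valued.v.restrict_le_iff, map_pow vv] using this

lemma tendsto_zero {α : Type*} {l : Filter α} {f : α → LX}
    (h : ∀ n : ℕ, ∀ᶠ a in l, vv (f a) ≤ vv qX ^ n) : Tendsto f l (𝓝 0) := by
  intro s hs
  obtain ⟨n, hn⟩ := nhds_zero_mem hs
  exact (h n).mono (fun a ha => hn ha)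

instance instNA : NonarchimedeanRing LX where
  is_nonarchimedean U hU := by
    obtain ⟨n, hn⟩ := nhds_zero_mem hU
    refine ⟨⟨⟨⟨⟨{y : LX | vv y ≤ vv qX ^ n}, ?_⟩, ?_⟩, ?_⟩, isOpen_b n⟩, hn⟩
    · intro a b ha hb; exact (vv.map_add _ _).trans (max_le ha hb)
    · simp
    · intro a ha; simpa using ha

lemma summable_of {f : ℕ → LX} (c : ℕ) (h : ∀ n, vv (f n) ≤ vv qX ^ (n - c)) : Summable f := by
  apply NonarchimedeanAddGroup.summable_of_tendsto_cofinite_zero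
  rw [Nat.cofinite_eq_atTop]
  apply tendsto_zero
  intro n
  filter_upwards [eventually_ge_atTop (n + c)] with m hm
  exact (h m).trans (pow_le_pow_right_of_le_one' v_q_le (by omega))

lemma v_tsum_le {f : ℕ → LX} (hf : Summable f) (h : ∀ n, vv (f n) ≤ 1) : vv (∑' n, f n) ≤ 1 := by
  have hc := isClosed_b 0
  have := hc.mem_of_tendsto hf.hasSum (Eventually.of_forall (fun s => ?_))
  · simpa using this
  · simp only [pow_zero, Set.mem_ofPred_eq]
    exact vv.map_sum_le (fun i _ => h i)

lemma mult_of {f : ℕ → LX} (h : ∀ n, vv (f n) ≤ vv qX ^ n) : Multipliable (fun n => 1 - f n) := by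
  simp only [sub_eq_add_neg]
  apply multipliable_one_add_of_summable_prod
  apply NonarchimedeanAddGroup.summable_of_tendsto_cofinite_zero
  apply tendsto_zero
  intro n
  rw [Filter.eventually_cofinite]
  apply (Finset.finite_toSet (Finset.range n).powerset).subset
  intro s hs
  simp only [Set.mem_ofPred_eq, map_prod] at hs
  simp only [Finset.coe_powerset, Set.mem_preimage, Set.mem_powerset_iff, Finset.coe_subset]
  intro m hm
  by_contra hmn
  apply hs
  simp only [Finset.mem_range, not_lt] at hmn
  rw [← Finset.mul_prod_erase _ _ hm, Valuation.map_neg]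
  calc _ ≤ vv qX ^ n * 1 := by
        gcongr
        · exact (h m).trans (pow_le_pow_right_of_le_one' v_q_le hmn)
        · apply Finset.prod_le_one'
          intro i _
          rw [Valuation.map_neg]
          exact (h i).trans (v_qpow_le i)
    _ = _ := mul_one _

lemma v_lim {u : ℕ → LX} {L : LX} (h : Tendsto u atTop (𝓝 L)) (hu : ∀ n, vv (u n) = 1) :
    vv L = 1 := by
  have h2 : Tendsto (fun n => u n - L) atTop (𝓝 0) := by
    simpa using h.sub_const L
  have h3 := h2 ((isOpen_b 1).mem_nhds (by simp))
  obtain ⟨n, hn⟩ := (Filter.mem_map.1 h3 |> fun h => Filter.Eventually.exists (p := fun n => vv (u n - L) ≤ vv qX ^ 1) h)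
  have h4 : vv (u n - L) < vv (u n) := by
    rw [hu]; refine lt_of_le_of_lt ?_ v_q_lt; simpa using hn
  rw [← hu n]
  rw [Valuation.map_sub_swap] at h4
  exact Valuation.map_eq_of_sub_lt _ h4

lemma v_one_sub {a : LX} (h : vv a < 1) : vv (1 - a) = 1 := by
  exact Valuation.map_one_sub_of_lt _ h

end TI

namespace TI

lemma v_qpow_lt (n : ℕ) : vv (qX ^ (n + 1)) < 1 := by
  rw [map_pow]; exact pow_lt_one' v_q_lt (by omega)

lemma v_one_sub_q (n : ℕ) : vv (1 - qX ^ (n + 1)) = 1 := v_one_sub (v_qpow_lt n)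

lemma ne_of_v {a : LX} (h : vv a = 1) : a ≠ 0 := by
  rintro rfl; rw [map_zero] at h; exact zero_ne_one h

def Q (n : ℕ) : LX := ∏ j ∈ Finset.range n, (1 - qX ^ (j + 1))

lemma Q_succ (n : ℕ) : Q (n + 1) = Q n * (1 - qX ^ (n + 1)) := Finset.prod_range_succ _ _

lemma v_Q (n : ℕ) : vv (Q n) = 1 := by
  rw [Q, map_prod]; exact Finset.prod_eq_one (fun j _ => v_one_sub_q j)

lemma Q_ne (n : ℕ) : Q n ≠ 0 := ne_of_v (v_Q n)

def R (n : ℤ) : LX := if n < 0 then 0 else (Q n.toNat)⁻¹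

lemma R_nat (n : ℕ) : R n = (Q n)⁻¹ := by simp [R]

lemma R_neg {n : ℤ} (h : n < 0) : R n = 0 := by simp [R, h]

lemma v_R (n : ℤ) : vv (R n) ≤ 1 := by
  unfold R; split_ifs
  · simp
  · rw [map_inv₀, v_Q, inv_one]

lemma R_rec (n : ℤ) : R (n - 1) = (1 - qX ^ n) * R n := by
  rcases lt_trichotomy n 0 with h | h | h
  · rw [R_neg h, R_neg (by omega), mul_zero]
  · subst h; rw [R_neg (by omega)]; simp
  · obtain ⟨m, rfl⟩ : ∃ m : ℕ, n = (m : ℤ) + 1 := ⟨(n - 1).toNat, by omega⟩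
    rw [add_sub_cancel_right, R_nat, show (m : ℤ) + 1 = ((m + 1 : ℕ) : ℤ) by push_cast; rfl, R_nat,
      zpow_natCast, Q_succ]
    have := Q_ne m
    have := ne_of_v (v_one_sub_q m)
    field_simp

def A (k i : ℕ) : LX :=
  (1 - qX ^ (2 * i + 1)) * Q (2 * k) * R ((k : ℤ) - i) * R ((k : ℤ) + i + 1)

lemma v_A (k i : ℕ) : vv (A k i) ≤ 1 := by
  unfold A
  rw [map_mul, map_mul, map_mul, v_Q, v_one_sub_q, one_mul, one_mul]
  exact mul_le_one' (v_R _) (v_R _)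

lemma A_zero {k i : ℕ} (h : k < i) : A k i = 0 := by
  unfold A
  rw [R_neg (n := (k : ℤ) - i) (by omega)]; simp

lemma A_rec (k i : ℕ) : A (k + 1) (i + 1) =
    (1 + qX ^ (2 * k)) * A k (i + 1) + qX ^ ((k : ℤ) - i) * A k i
      + qX ^ (k + i + 1) * A k (i + 2) := by
  have hq := q_ne
  have e1 : R ((k : ℤ) - i - 1) = (1 - qX ^ ((k : ℤ) - i)) * R ((k : ℤ) - i) := R_rec _
  have e2 : R ((k : ℤ) - i - 1 - 1) = (1 - qX ^ ((k : ℤ) - i - 1)) * R ((k : ℤ) - i - 1) := R_rec _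
  have e3 : R ((k : ℤ) + i + 3 - 1) = (1 - qX ^ ((k : ℤ) + i + 3)) * R ((k : ℤ) + i + 3) := R_rec _
  have e4 : R ((k : ℤ) + i + 3 - 1 - 1)
    = (1 - qX ^ ((k : ℤ) + i + 3 - 1)) * R ((k : ℤ) + i + 3 - 1) := R_rec _
  have e5 : Q (2 * (k + 1)) = Q (2 * k) * (1 - qX ^ (2 * k + 1)) * (1 - qX ^ (2 * k + 2)) := by
    rw [show 2 * (k + 1) = 2 * k + 1 + 1 by ring, Q_succ, Q_succ]
  unfold A
  rw [e5]
  push_cast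
  rw [show (k : ℤ) + 1 - (i + 1) = k - i by ring, show (k : ℤ) + 1 + (i + 1) + 1 = k + i + 3 by ring,
    show (k : ℤ) - (i + 1) = k - i - 1 by ring, show (k : ℤ) + (i + 1) + 1 = k + i + 3 - 1 by ring,
    show (k : ℤ) - (i + 2) = k - i - 1 - 1 by ring, show (k : ℤ) + (i + 2) + 1 = k + i + 3 by ring,
    show (k : ℤ) + i + 1 = k + i + 3 - 1 - 1 by ring, e4, e3, e2, e1]
  generalize R ((k : ℤ) - i) = r
  generalize R ((k : ℤ) + i + 3) = s
  generalize Q (2 * k) = u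
  have z1 : qX ^ ((k : ℤ) - i) = qX ^ k / qX ^ i := by
    rw [zpow_sub₀ hq, zpow_natCast, zpow_natCast]
  have z2 : qX ^ ((k : ℤ) - i - 1) = qX ^ k / qX ^ i / qX := by
    rw [zpow_sub₀ hq, z1, zpow_one]
  have z3 : qX ^ ((k : ℤ) + i + 3) = qX ^ k * qX ^ i * qX ^ 3 := by
    rw [show (k : ℤ) + i + 3 = ((k + i + 3 : ℕ) : ℤ) by push_cast; rfl, zpow_natCast]; ring
  have z4 : qX ^ ((k : ℤ) + i + 3 - 1) = qX ^ k * qX ^ i * qX ^ 2 := by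
    rw [show (k : ℤ) + i + 3 - 1 = ((k + i + 2 : ℕ) : ℤ) by push_cast; ring, zpow_natCast]; ring
  rw [z1, z2, z3, z4]
  have y1 : qX ^ (2 * (i + 1) + 1) = (qX ^ i) ^ 2 * qX ^ 3 := by ring
  have y2 : qX ^ (2 * k + 1) = (qX ^ k) ^ 2 * qX := by ring
  have y3 : qX ^ (2 * k + 2) = (qX ^ k) ^ 2 * qX ^ 2 := by ring
  have y4 : qX ^ (2 * k) = (qX ^ k) ^ 2 := by ring
  have y5 : qX ^ (2 * i + 1) = (qX ^ i) ^ 2 * qX := by ring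
  have y6 : qX ^ (k + i + 1) = qX ^ k * qX ^ i * qX := by ring
  have y7 : qX ^ (2 * (i + 2) + 1) = (qX ^ i) ^ 2 * qX ^ 5 := by ring
  rw [y1, y2, y3, y4, y5, y6, y7]
  have hi : qX ^ i ≠ 0 := pow_ne_zero _ hq
  generalize qX ^ i = b at *
  generalize qX ^ k = a at *
  generalize qX = q at *
  field_simp
  ring

def B (k : ℕ) : LX := (pochL Cx (k + 1) * pochL (qX * Cx⁻¹) k)⁻¹

lemma v_px (k : ℕ) : vv (1 - Cx * qX ^ k) = 1 := by
  cases k with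
  | zero => simpa using v_one_sub_x
  | succ n => apply v_one_sub; rw [map_mul, v_x, one_mul]; exact v_qpow_lt n

lemma v_py (k : ℕ) : vv (1 - Cx⁻¹ * qX ^ (k + 1)) = 1 := by
  apply v_one_sub; rw [map_mul, v_y, one_mul]; exact v_qpow_lt k

lemma pochX (k : ℕ) : vv (pochL Cx k) = 1 := by
  rw [pochL, map_prod]; exact Finset.prod_eq_one (fun j _ => v_px j)

lemma pochY_eq (k : ℕ) : pochL (qX * Cx⁻¹) k = ∏ j ∈ Finset.range k, (1 - Cx⁻¹ * qX ^ (j + 1)) := by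
  unfold pochL; apply Finset.prod_congr rfl; intro j _; ring

lemma pochY (k : ℕ) : vv (pochL (qX * Cx⁻¹) k) = 1 := by
  rw [pochY_eq, map_prod]; exact Finset.prod_eq_one (fun j _ => v_py j)

lemma v_B (k : ℕ) : vv (B k) = 1 := by
  rw [B, map_inv₀, map_mul, pochX, pochY, one_mul, inv_one]

lemma B_succ (k : ℕ) :
    B k = B (k + 1) * ((1 - Cx * qX ^ (k + 1)) * (1 - Cx⁻¹ * qX ^ (k + 1))) := by
  have h1 := ne_of_v (v_px (k + 1))
  have h2 := ne_of_v (v_py k)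
  have h3 := ne_of_v (pochX (k + 1))
  have h4 := ne_of_v (pochY k)
  have e1 : pochL Cx (k + 1 + 1) = pochL Cx (k + 1) * (1 - Cx * qX ^ (k + 1)) :=
    Finset.prod_range_succ _ _
  have e2 : pochL (qX * Cx⁻¹) (k + 1) = pochL (qX * Cx⁻¹) k * (1 - Cx⁻¹ * qX ^ (k + 1)) := by
    rw [pochY_eq, pochY_eq]; exact Finset.prod_range_succ _ _
  unfold B
  rw [e1, e2, mul_mul_mul_comm, mul_inv _ ((1 - Cx * qX ^ (k + 1)) * _), mul_assoc,
    inv_mul_cancel₀ (mul_ne_zero h1 h2), mul_one]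

def T (i k : ℕ) : LX := qX ^ ((k : ℤ) - i) * A k i * B k

lemma T_zero {i k : ℕ} (h : k < i) : T i k = 0 := by rw [T, A_zero h]; simp

lemma v_T (i k : ℕ) : vv (T i k) ≤ vv qX ^ (k - i) := by
  rcases lt_or_ge k i with h | h
  · rw [T_zero h]; simp
  · unfold T
    rw [show (k : ℤ) - i = ((k - i : ℕ) : ℤ) by omega, zpow_natCast, map_mul, map_mul, v_B, mul_one,
      map_pow]
    exact mul_le_of_le_one_right' (v_A _ _)

lemma T_sum (i N : ℕ) : ∑ k ∈ Finset.range (N + 1),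
    (T i k + qX ^ (i + 1) * (Cx + Cx⁻¹) * T (i + 1) k + qX ^ (2 * i + 3) * T (i + 2) k)
      = A (N + 1) (i + 1) * B N := by
  have hq := q_ne
  have w1 : ∀ k : ℕ, qX ^ (i + 1) * qX ^ ((k : ℤ) - (i + 1 : ℕ)) = qX ^ k := by
    intro k
    rw [← zpow_natCast, ← zpow_add₀ hq, ← zpow_natCast]; congr 1; ring
  have w2 : ∀ k : ℕ, qX ^ (2 * i + 3) * qX ^ ((k : ℤ) - (i + 2 : ℕ)) = qX ^ (k + i + 1) := by
    intro k
    rw [← zpow_natCast, ← zpow_add₀ hq, ← zpow_natCast]; congr 1; push_cast; ring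
  have w3 : ∀ k : ℕ,
     T i k + qX ^ (i + 1) * (Cx + Cx⁻¹) * T (i + 1) k + qX ^ (2 * i + 3) * T (i + 2) k
      = (qX ^ ((k : ℤ) - i) * A k i + qX ^ k * (Cx + Cx⁻¹) * A k (i + 1)
        + qX ^ (k + i + 1) * A k (i + 2)) * B k := by
    intro k
    unfold T
    rw [← w1 k, ← w2 k]; ring
  simp only [w3]
  induction N with
  | zero =>
    rw [zero_add, Finset.sum_range_one, A_rec, A_zero (k := 0) (i := i + 1) (by omega)]
    ring
  | succ N ih =>
    rw [Finset.sum_range_succ, ih, B_succ N, A_rec (N + 1) i]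
    have : Cx * Cx⁻¹ = 1 := mul_inv_cancel₀ x_ne
    linear_combination (A (N+1) (i+1) * B (N+1) * (qX ^ (N + 1)) ^ 2) * this

lemma tQ : Tendsto Q atTop (𝓝 (∏' n : ℕ, (1 - qX ^ (n + 1)))) := by
  apply Multipliable.tendsto_prod_tprod_nat
  apply mult_of; intro n; rw [map_pow]
  exact pow_le_pow_right_of_le_one' v_q_le (by omega)

lemma tX : Tendsto (pochL Cx) atTop (𝓝 (∏' n : ℕ, (1 - Cx * qX ^ n))) := by
  apply Multipliable.tendsto_prod_tprod_nat
  apply mult_of; intro n; rw [map_mul, v_x, map_pow, one_mul]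

lemma tY : Tendsto (pochL (qX * Cx⁻¹)) atTop (𝓝 (∏' n : ℕ, (1 - Cx⁻¹ * qX ^ (n + 1)))) := by
  rw [show pochL (qX * Cx⁻¹) = _ from funext pochY_eq]
  apply Multipliable.tendsto_prod_tprod_nat
  apply mult_of; intro n; rw [map_mul, v_y, map_pow, one_mul]
  exact pow_le_pow_right_of_le_one' v_q_le (by omega)

lemma v_pochInf : vv pochInf = 1 := by
  unfold pochInf
  rw [map_mul, map_mul, v_lim tQ v_Q, v_lim tX pochX, v_lim tY pochY]; simp

lemma t_AB (i : ℕ) : Tendsto (fun N => A (N + 1) (i + 1) * B N) atTop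
    (𝓝 ((1 - qX ^ (2 * i + 3)) * pochInf⁻¹)) := by
  have nq := ne_of_v (v_lim tQ v_Q)
  have nx := ne_of_v (v_lim tX pochX)
  have ny := ne_of_v (v_lim tY pochY)
  have h1 : Tendsto (fun N : ℕ => Q (2 * (N + 1))) atTop (𝓝 (∏' n : ℕ, (1 - qX ^ (n + 1)))) :=
    tQ.comp (tendsto_atTop_mono (fun n => by show n ≤ 2 * (n + 1); omega) tendsto_id)
  have h2 : Tendsto (fun N : ℕ => (Q (N - i))⁻¹) atTop (𝓝 (∏' n : ℕ, (1 - qX ^ (n + 1)))⁻¹) :=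
    (tQ.comp (tendsto_sub_atTop_nat i)).inv₀ nq
  have h3 : Tendsto (fun N : ℕ => (Q (N + (i + 3)))⁻¹) atTop
      (𝓝 (∏' n : ℕ, (1 - qX ^ (n + 1)))⁻¹) :=
    (tQ.comp (tendsto_add_atTop_nat (i + 3))).inv₀ nq
  have h4 := ((tX.comp (tendsto_add_atTop_nat 1)).mul tY).inv₀ (mul_ne_zero nx ny)
  have h5 := ((((tendsto_const_nhds (x := 1 - qX ^ (2 * i + 3))).mul h1).mul h2).mul h3).mul h4
  have e : ∀ a b c r : LX, a ≠ 0 → b ≠ 0 → c ≠ 0 →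
      r * (a * b * c)⁻¹ = r * a * a⁻¹ * a⁻¹ * (b * c)⁻¹ := by
    intro a b c r ha hb hc
    field_simp
  unfold pochInf
  rw [e _ _ _ _ nq nx ny]
  refine h5.congr' ?_
  filter_upwards [eventually_ge_atTop i] with N hN
  unfold A B
  rw [show ((N + 1 : ℕ) : ℤ) - (i + 1 : ℕ) = ((N - i : ℕ) : ℤ) by omega,
    show ((N + 1 : ℕ) : ℤ) + (i + 1 : ℕ) + 1 = ((N + (i + 3) : ℕ) : ℤ) by push_cast; ring,
    R_nat, R_nat]
  rfl

def S (i : ℕ) : LX := ∑' k, T i k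

lemma sumT (i : ℕ) : Summable (T i) := summable_of i (v_T i)

lemma v_S (i : ℕ) : vv (S i) ≤ 1 :=
  v_tsum_le (sumT i) (fun k => (v_T i k).trans (v_qpow_le _))

lemma S_rec (i : ℕ) : S i + qX ^ (i + 1) * (Cx + Cx⁻¹) * S (i + 1) + qX ^ (2 * i + 3) * S (i + 2)
    = (1 - qX ^ (2 * i + 3)) * pochInf⁻¹ := by
  have h := (((sumT i).hasSum.add ((sumT (i + 1)).hasSum.mul_left (qX ^ (i + 1) * (Cx + Cx⁻¹)))).add
    ((sumT (i + 2)).hasSum.mul_left (qX ^ (2 * i + 3)))).tendsto_sum_nat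
  have h' := h.comp (tendsto_add_atTop_nat 1)
  refine tendsto_nhds_unique h' ?_
  refine (t_AB i).congr (fun N => ?_)
  exact (T_sum i N).symm

def pt (i : ℕ) (z : LX) (n : ℕ) : LX := (-1) ^ n * qX ^ (n * (n + 1) / 2 + n * i) * z ^ n

lemma v_pt (i : ℕ) (z : LX) (hz : vv z = 1) (n : ℕ) : vv (pt i z n) ≤ vv qX ^ (n - 0) := by
  unfold pt
  rw [map_mul, map_mul, map_pow, map_pow, map_pow, Valuation.map_neg, map_one, hz, one_pow, one_mul,
    mul_one]
  apply pow_le_pow_right_of_le_one' v_q_le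
  have : n ≤ n * (n + 1) / 2 := by
    rw [Nat.le_div_iff_mul_le (by norm_num)]
    rcases n with _ | n
    · simp
    · gcongr; omega
  omega

lemma sum_pt (i : ℕ) (z : LX) (hz : vv z = 1) : Summable (pt i z) := summable_of 0 (v_pt i z hz)

def P (i : ℕ) (z : LX) : LX := ∑' n, pt i z n

lemma tri (n : ℕ) : (n + 1) * (n + 2) / 2 = n * (n + 1) / 2 + (n + 1) := by
  rw [show (n + 1) * (n + 2) = n * (n + 1) + (n + 1) * 2 by ring,
    Nat.add_mul_div_right _ _ (by norm_num)]

lemma pt_succ (i : ℕ) (z : LX) (n : ℕ) : pt i z (n + 1) = -(qX ^ (i + 1) * z) * pt (i + 1) z n := by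
  unfold pt
  rw [show n + 1 + 1 = n + 2 by ring, tri]
  ring

lemma P_rec (i : ℕ) (z : LX) (hz : vv z = 1) : P i z = 1 - qX ^ (i + 1) * z * P (i + 1) z := by
  unfold P
  rw [(sum_pt i z hz).tsum_eq_zero_add]
  simp only [pt_succ]
  rw [(sum_pt (i + 1) z hz).tsum_mul_left]
  simp [pt]; ring

def Th (i : ℕ) : LX := P i Cx + P i Cx⁻¹ - 1

lemma v_Th (i : ℕ) : vv (Th i) ≤ 1 := by
  unfold Th
  have h : ∀ z, vv z = 1 → vv (P i z) ≤ 1 := fun z hz =>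
    v_tsum_le (sum_pt i z hz) (fun k => (v_pt i z hz k).trans (v_qpow_le _))
  refine (vv.map_sub _ _).trans (max_le ((vv.map_add _ _).trans (max_le ?_ ?_)) (by simp))
  · exact h _ v_x
  · exact h _ v_y

lemma Th_rec (i : ℕ) :
    Th i + qX ^ (i + 1) * (Cx + Cx⁻¹) * Th (i + 1) + qX ^ (2 * i + 3) * Th (i + 2)
    = 1 - qX ^ (2 * i + 3) := by
  have h : Cx * Cx⁻¹ = 1 := mul_inv_cancel₀ x_ne
  unfold Th
  have a1 := P_rec i Cx v_x
  have a2 := P_rec (i + 1) Cx v_x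
  have b1 := P_rec i Cx⁻¹ v_y
  have b2 := P_rec (i + 1) Cx⁻¹ v_y
  rw [show i + 1 + 1 = i + 2 by ring] at a2 b2
  have e : qX ^ (2 * i + 3) = qX ^ (i + 1) * qX ^ (i + 2) := by ring
  rw [e]
  linear_combination a1 + b1 + qX ^ (i + 1) * Cx⁻¹ * a2 + qX ^ (i + 1) * Cx * b2
    - qX ^ (i + 1) * qX ^ (i + 2) * (P (i + 2) Cx + P (i + 2) Cx⁻¹) * h

lemma θ_eq (i : ℕ) : θ i = (-1 : LX) ^ i * qX ^ (i * (i + 1) / 2) * Th i := by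
  unfold θ Th P
  congr 1
  have hx := sum_pt i Cx v_x
  have hy := sum_pt i Cx⁻¹ v_y
  rw [hx.tsum_eq_zero_add, hy.tsum_eq_zero_add]
  have e : ∀ n : ℕ, (-1 : LX) ^ (n + 1) * qX ^ ((n + 1) * (n + 2) / 2 + (n + 1) * i) *
      (Cx ^ (n + 1) + Cx⁻¹ ^ (n + 1)) = pt i Cx (n + 1) + pt i Cx⁻¹ (n + 1) := by
    intro n; unfold pt; rw [mul_add]
  simp only [e]
  rw [((summable_nat_add_iff 1).2 hx).tsum_add ((summable_nat_add_iff 1).2 hy)]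
  simp only [pt]
  simp
  ring

lemma S_eq (i : ℕ) : S i = Th i * pochInf⁻¹ := by
  set D : ℕ → LX := fun i => S i - Th i * pochInf⁻¹ with hD
  have hrec : ∀ i, D i = -(qX ^ (i + 1) * (Cx + Cx⁻¹) * D (i + 1) + qX ^ (2 * i + 3) * D (i + 2)) := by
    intro i
    simp only [hD]
    linear_combination S_rec i - pochInf⁻¹ * Th_rec i
  have hv : ∀ n i, vv (D i) ≤ vv qX ^ n := by
    intro n
    induction n with
    | zero =>
      intro i
      rw [pow_zero]
      refine (vv.map_sub _ _).trans (max_le (v_S i) ?_)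
      rw [map_mul, map_inv₀, v_pochInf, inv_one, mul_one]; exact v_Th i
    | succ n ih =>
      intro i
      rw [hrec i, Valuation.map_neg]
      refine (vv.map_add _ _).trans (max_le ?_ ?_)
      · rw [map_mul, map_mul, map_pow, pow_succ' _ i, pow_succ']
        have : vv (Cx + Cx⁻¹) ≤ 1 := (vv.map_add _ _).trans (by rw [v_x, v_y]; simp)
        calc _ ≤ vv qX * 1 * 1 * vv qX ^ n := by gcongr; exacts [v_qpow_le _, ih _]
          _ = _ := by simp
      · rw [map_mul, map_pow, pow_succ' _ (2 * i + 2), pow_succ' _ n]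
        calc _ ≤ vv qX * 1 * vv qX ^ n := by gcongr; exacts [v_qpow_le _, ih _]
          _ = _ := by simp
  have h0 : D i = 0 := by
    have : Tendsto (fun _ : ℕ => D i) atTop (𝓝 0) :=
      tendsto_zero (fun n => Eventually.of_forall (fun _ => hv n i))
    exact tendsto_nhds_unique tendsto_const_nhds this
  exact sub_eq_zero.1 h0

lemma prod1 (m d : ℕ) :
    (∏ j ∈ Finset.range d, (qX ^ (((m + d : ℕ) : ℤ) - j) - 1)) * Q m = (-1) ^ d * Q (m + d) := by
  induction d with
  | zero => simp
  | succ d ih =>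
    rw [Finset.prod_range_succ', ← add_assoc, Q_succ]
    have : ∀ j ∈ Finset.range d, qX ^ (((m + d + 1 : ℕ) : ℤ) - ((j + 1 : ℕ) : ℤ)) - 1
        = qX ^ (((m + d : ℕ) : ℤ) - j) - 1 := by
      intro j _; congr 2; push_cast; ring
    rw [Finset.prod_congr rfl this, Nat.cast_zero, sub_zero, zpow_natCast]
    linear_combination (qX ^ (m + d + 1) - 1) * ih

lemma term_eq (i k : ℕ) :
    coefA i k * σt k = (-1 : LX) ^ i * qX ^ (i * (i + 1) / 2) * T i k := by
  rcases lt_or_ge k i with h | h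
  · rw [T_zero h, coefA, if_pos h]; simp
  obtain ⟨d, rfl⟩ := Nat.exists_eq_add_of_le h
  have hq := q_ne
  rw [coefA, if_neg (by omega)]
  unfold σt T A
  rw [← B]
  have p1 := prod1 (i + d + i) d
  have p2 := prod1 0 d
  rw [show i + d - i = d by omega]
  rw [show ((i + d : ℕ) : ℤ) - i = d by push_cast; ring]
  rw [show ((i + d : ℕ) : ℤ) + i + 1 = ((i + d + i + 1 : ℕ) : ℤ) by push_cast; ring, R_nat, R_nat,
    Q_succ]
  rw [show ((i + d + i + d : ℕ) : ℤ) = 2 * ((i + d : ℕ) : ℤ) by push_cast; ring,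
    show i + d + i + d = 2 * (i + d) by ring] at p1
  rw [show Q 0 = 1 from Finset.prod_range_zero _, mul_one, zero_add] at p2
  rw [p2]
  have n1 := Q_ne (i + d + i)
  have n2 := Q_ne d
  have n3 := ne_of_v (v_one_sub_q (i + d + i))
  rw [eq_div_of_mul_eq n1 p1]
  have ex : qX ^ ((d : ℤ) * (1 - (((i + d : ℕ) : ℤ) + i)) / 2) * qX ^ ((i + d) * (i + d + 1) / 2)
      = qX ^ (i * (i + 1) / 2) * qX ^ (d : ℤ) := by
    rw [← zpow_natCast, ← zpow_natCast, ← zpow_add₀ hq, ← zpow_add₀ hq]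
    congr 1
    push_cast
    have f1 : (2 : ℤ) ∣ (i + d) * (i + d + 1) := (Int.even_mul_succ_self _).two_dvd
    have f2 : (2 : ℤ) ∣ i * (i + 1) := (Int.even_mul_succ_self _).two_dvd
    have f3 : (d : ℤ) * (1 - (i + d + i))
        = i * (i + 1) + 2 * d - (i + d) * (i + d + 1) := by ring
    rw [f3]
    omega
  have n4 : qX ^ (i + d + i + 1) - 1 ≠ 0 := by
    rw [← neg_sub]; exact neg_ne_zero.2 n3
  have sg : (-1 : LX) ^ (i + d + i) * (-1) ^ (i + d) = (-1) ^ i := by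
    rw [← pow_add, show i + d + i + (i + d) = i + 2 * (i + d) by ring, pow_add, pow_mul,
      show (-1 : LX) ^ 2 = 1 by ring, one_pow, mul_one]
  have n5 : ((-1 : LX) ^ d) ≠ 0 := by simp
  have n6 : (qX ^ (i + d + i + 1) - 1)⁻¹ = -(1 - qX ^ (i + d + i + 1))⁻¹ := by
    apply mul_left_cancel₀ n4
    rw [mul_inv_cancel₀ n4]
    linear_combination -(mul_inv_cancel₀ n3)
  rw [n6]
  calc _ = ((-1 : LX) ^ (i + d + i) * (-1) ^ (i + d)) *
       (qX ^ ((d : ℤ) * (1 - (((i + d : ℕ) : ℤ) + i)) / 2) * qX ^ ((i + d) * (i + d + 1) / 2)) *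
       (((-1) ^ d * Q (2 * (i + d)) / Q (i + d + i)) * ((-1) ^ d * Q d)⁻¹ * (qX ^ (2 * i + 1) - 1) *
        -(1 - qX ^ (i + d + i + 1))⁻¹) * B (i + d) := by ring
    _ = _ := by
      rw [sg, ex]
      generalize (-1 : LX) ^ d = e at *
      field_simp
      ring

end TI

theorem theta_identity (i : ℕ) :
    Summable (fun k : ℕ => coefA i k * σt k) ∧
    ∑' k : ℕ, coefA i k * σt k = θ i * pochInf⁻¹ := by
  simp only [TI.term_eq]
  refine ⟨(TI.sumT i).mul_left _, ?_⟩
  rw [(TI.sumT i).tsum_mul_left, TI.θ_eq, mul_assoc _ (TI.Th i), ← TI.S_eq]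
  rfl
end
end

section
/- For every integer k ≥ 0 and every integer j with −k ≤ j ≤ k, the rational function (x − q^j)·σ̃_{−k−1}(x) ∈ ℚ(q)(x) has no pole at x = q^j, and its value at x = q^j equals −(−1)^{k+j}·q^{j(j+1)/2 + k(k+1)/2}·((q)_{k−j}·(q)_{k+j})⁻¹; that is, the residue of the meromorphic 1-form σ̃_{−k−1} dx at its simple pole x = q^j is −(−1)^{k+j} q^{j(j+1)/2+k(k+1)/2}/((q)_{k−j}(q)_{k+j}). -/
noncomputable section

/-- The field `ℚ(q)`. -/
abbrev Fq : Type := RatFunc ℚ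

/-- The variable `q` of `ℚ(q)`. -/
def qv : Fq := RatFunc.X

/-- `(q)_m = ∏_{i=1}^{m}(1−qⁱ)` in `ℚ(q)`. -/
def qP (m : ℕ) : Fq := ∏ i ∈ Finset.range m, (1 - qv ^ (i + 1))

/-- The field `ℚ(q)(x)` of rational functions in `x` over `ℚ(q)`. -/
abbrev FX : Type := RatFunc Fq

/-- The variable `x` of `ℚ(q)(x)`. -/
def xV : FX := RatFunc.X

/-- `σ̃_{−k−1} = (x⁻¹−1)·∏_{i=0}^{k}(x+x⁻¹−qⁱ−q⁻ⁱ)⁻¹` in `ℚ(q)(x)`. -/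
def σtR (k : ℕ) : FX :=
  (xV⁻¹ - 1) * (∏ i ∈ Finset.range (k + 1),
    (xV + xV⁻¹ - RatFunc.C (qv ^ (i : ℤ)) - RatFunc.C (qv ^ (-(i : ℤ)))))⁻¹

/-- `R_{k,j} = −(−1)^{k+j}·q^{j(j+1)/2 + k(k+1)/2}·((q)_{k−j}·(q)_{k+j})⁻¹`. -/
def Rres (k : ℕ) (j : ℤ) : Fq :=
  -((-1 : Fq) ^ ((k : ℤ) + j) * qv ^ (j * (j + 1) / 2 + (k : ℤ) * ((k : ℤ) + 1) / 2) *
    (qP ((k : ℤ) - j).toNat * qP ((k : ℤ) + j).toNat)⁻¹)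

/-!
STATEMENT 9: For every integer k ≥ 0 and every integer j with −k ≤ j ≤ k, the
rational function (x − q^j)·σ̃_{−k−1}(x) ∈ ℚ(q)(x) has no pole at x = q^j (its
denominator in lowest terms does not vanish at q^j), and its value at x = q^j
equals −(−1)^{k+j}·q^{j(j+1)/2 + k(k+1)/2}·((q)_{k−j}·(q)_{k+j})⁻¹; i.e. the
residue of σ̃_{−k−1} dx at its simple pole x = q^j is this quantity.
-/

theorem aux_prod {M : Type*} [CommMonoid M] (f : ℤ → M) (j : ℤ) (a b : ℕ) :
    (∏ m ∈ Finset.range a, f (j - (m + 1))) * f j * ∏ m ∈ Finset.range b, f (j + (m + 1))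
      = ∏ i ∈ Finset.range (a + b + 1), f (j - a + i) := by
  induction b with
  | zero =>
    simp only [Finset.range_zero, Finset.prod_empty, mul_one, add_zero]
    rw [Finset.prod_range_succ, ← Finset.prod_range_reflect]
    congr 1
    · refine Finset.prod_congr rfl fun m hm => ?_
      have := Finset.mem_range.1 hm
      congr 1
      omega
    · congr 1; omega
  | succ b ih =>
    rw [Finset.prod_range_succ, ← mul_assoc, ih, ← add_assoc a b 1,
      Finset.prod_range_succ _ (a + b + 1)]
    congr 2
    push_cast; ring

theorem qv_ne : qv ≠ 0 := RatFunc.X_ne_zero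

theorem qv_pow_ne (m : ℕ) : (1 : Fq) - qv ^ (m + 1) ≠ 0 := by
  intro h
  have h2 : (algebraMap (Polynomial ℚ) (RatFunc ℚ)) (Polynomial.X ^ (m + 1)) = algebraMap _ _ 1 := by
    rw [map_pow, RatFunc.algebraMap_X, map_one]
    exact (sub_eq_zero.1 h).symm
  have h3 := RatFunc.algebraMap_injective ℚ h2
  have h4 := congrArg Polynomial.natDegree h3
  simp at h4

theorem qP_ne (m : ℕ) : qP m ≠ 0 := Finset.prod_ne_zero_iff.2 fun i _ => qv_pow_ne i

theorem aux_lin_ne (c : Fq) : xV - RatFunc.C c ≠ 0 := by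
  have : xV - RatFunc.C c = algebraMap (Polynomial Fq) FX (Polynomial.X - Polynomial.C c) := by
    simp [xV, RatFunc.algebraMap_X, RatFunc.algebraMap_C]
  rw [this]
  exact RatFunc.algebraMap_ne_zero (Polynomial.X_sub_C_ne_zero c)

theorem aux_sigma (k : ℕ) : σtR k =
    -xV ^ k * (∏ i ∈ Finset.range (k + k + 1), (xV - RatFunc.C (qv ^ (0 - (k : ℤ) + i))))⁻¹ := by
  rw [← aux_prod (fun i : ℤ => xV - RatFunc.C (qv ^ i)) 0 k k]
  have hx : xV ≠ 0 := RatFunc.X_ne_zero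
  have h1 : xV - 1 ≠ 0 := by simpa using aux_lin_ne 1
  have hfac : ∀ i : ℕ, xV + xV⁻¹ - RatFunc.C (qv ^ (i : ℤ)) - RatFunc.C (qv ^ (-(i : ℤ)))
      = (xV - RatFunc.C (qv ^ (i : ℤ))) * (xV - RatFunc.C (qv ^ (-(i : ℤ)))) * xV⁻¹ := by
    intro i
    have : RatFunc.C (qv ^ (i : ℤ)) * RatFunc.C (qv ^ (-(i : ℤ))) = (1 : FX) := by
      rw [← map_mul, ← zpow_add₀ qv_ne]; simp
    generalize RatFunc.C (qv ^ (i : ℤ)) = a at *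
    generalize RatFunc.C (qv ^ (-(i : ℤ))) = b at *
    field_simp
    linear_combination -this
  unfold σtR
  rw [Finset.prod_congr rfl fun i _ => hfac i, Finset.prod_range_succ', Finset.prod_mul_distrib,
    Finset.prod_mul_distrib, Finset.prod_const, Finset.card_range]
  have e1 : ∏ m ∈ Finset.range k, (xV - RatFunc.C (qv ^ ((0 : ℤ) - (m + 1))))
      = ∏ m ∈ Finset.range k, (xV - RatFunc.C (qv ^ (-((m + 1 : ℕ) : ℤ)))) := by
    refine Finset.prod_congr rfl fun m _ => ?_
    push_cast; rw [zero_sub]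
  have e2 : ∏ m ∈ Finset.range k, (xV - RatFunc.C (qv ^ ((0 : ℤ) + (m + 1))))
      = ∏ m ∈ Finset.range k, (xV - RatFunc.C (qv ^ (((m + 1 : ℕ) : ℤ)))) := by
    refine Finset.prod_congr rfl fun m _ => ?_
    push_cast; rw [zero_add]
  rw [e1, e2]
  have n1 : ∏ m ∈ Finset.range k, (xV - RatFunc.C (qv ^ (-((m + 1 : ℕ) : ℤ)))) ≠ 0 :=
    Finset.prod_ne_zero_iff.2 fun i _ => aux_lin_ne _
  have n2 : ∏ m ∈ Finset.range k, (xV - RatFunc.C (qv ^ (((m + 1 : ℕ) : ℤ)))) ≠ 0 :=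
    Finset.prod_ne_zero_iff.2 fun i _ => aux_lin_ne _
  generalize ∏ m ∈ Finset.range k, (xV - RatFunc.C (qv ^ (-((m + 1 : ℕ) : ℤ)))) = A at *
  generalize ∏ m ∈ Finset.range k, (xV - RatFunc.C (qv ^ (((m + 1 : ℕ) : ℤ)))) = B at *
  simp only [Nat.cast_zero, neg_zero, zpow_zero, map_one, inv_pow]
  field_simp
  ring

theorem aux_eval (p d : Polynomial Fq) (a : Fq) (h : d.eval a ≠ 0) (f : FX)
    (hf : f = algebraMap _ _ p / algebraMap _ _ d) :
    Polynomial.eval a f.denom ≠ 0 ∧ RatFunc.eval (RingHom.id Fq) a f = p.eval a / d.eval a := by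
  have hd : d ≠ 0 := by rintro rfl; simp at h
  have h1 : Polynomial.eval a f.denom ≠ 0 := by
    intro h0
    obtain ⟨c, hc⟩ := hf ▸ RatFunc.denom_div_dvd p d
    apply h
    rw [hc, Polynomial.eval_mul, h0, zero_mul]
  refine ⟨h1, ?_⟩
  have h2 : f.num * d = p * f.denom := by
    exact (RatFunc.num_mul_eq_mul_denom_iff hd).2 hf
  have h3 := congrArg (Polynomial.eval a) h2
  simp only [Polynomial.eval_mul] at h3
  rw [RatFunc.eval, Polynomial.eval₂_id, Polynomial.eval₂_id, div_eq_div_iff h1 h]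
  exact h3

theorem aux_tri (n : ℕ) (j : ℤ) : ∏ m ∈ Finset.range n, (qv ^ j - qv ^ (j - ((m : ℤ) + 1)))
    = (-1) ^ n * qv ^ (j * n - (n : ℤ) * (n + 1) / 2) * qP n := by
  induction n with
  | zero => simp [qP]
  | succ n ih =>
    have e : j * ((n + 1 : ℕ) : ℤ) - ((n + 1 : ℕ) : ℤ) * ((n + 1 : ℕ) + 1) / 2
        = (j * n - (n : ℤ) * (n + 1) / 2) + (j - (n + 1)) := by
      have : ((n + 1 : ℕ) : ℤ) * ((n + 1 : ℕ) + 1) = (n : ℤ) * (n + 1) + (n + 1) * 2 := by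
        push_cast; ring
      rw [this, Int.add_mul_ediv_right _ _ (by norm_num)]
      push_cast; ring
    have e3 : qv ^ j = qv ^ (j - ((n : ℤ) + 1)) * qv ^ (n + 1) := by
      rw [← zpow_natCast, ← zpow_add₀ qv_ne]; congr 1; push_cast; ring
    rw [Finset.prod_range_succ, ih, e, zpow_add₀ qv_ne _ (j - (n + 1)), e3]
    have e4 : qP (n + 1) = qP n * (1 - qv ^ (n + 1)) := Finset.prod_range_succ _ _
    rw [e4]
    ring

theorem aux_up (n : ℕ) (j : ℤ) : ∏ m ∈ Finset.range n, (qv ^ j - qv ^ (j + ((m : ℤ) + 1)))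
    = qv ^ (j * n) * qP n := by
  rw [zpow_mul, zpow_natCast, qP, ← Finset.card_range n, ← Finset.prod_const, Finset.card_range,
    ← Finset.prod_mul_distrib]
  refine Finset.prod_congr rfl fun m _ => ?_
  rw [zpow_add₀ qv_ne]
  have : qv ^ ((m : ℤ) + 1) = qv ^ (m + 1) := by rw [← zpow_natCast]; push_cast; rfl
  rw [this]; ring

theorem residues_of_sigma_tilde (k : ℕ) (j : ℤ) (h₁ : -(k : ℤ) ≤ j) (h₂ : j ≤ (k : ℤ)) :
    Polynomial.eval (qv ^ j) ((xV - RatFunc.C (qv ^ j)) * σtR k).denom ≠ 0 ∧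
    RatFunc.eval (RingHom.id Fq) (qv ^ j) ((xV - RatFunc.C (qv ^ j)) * σtR k)
      = Rres k j := by
  obtain ⟨n, hn⟩ : ∃ n : ℕ, (k : ℤ) + j = n := ⟨((k : ℤ) + j).toNat, by omega⟩
  obtain ⟨l, hl⟩ : ∃ l : ℕ, (k : ℤ) - j = l := ⟨((k : ℤ) - j).toNat, by omega⟩
  have hev : Polynomial.eval (qv ^ j)
      ((∏ m ∈ Finset.range n, (Polynomial.X - Polynomial.C (qv ^ (j - ((m : ℤ) + 1))))) *
       ∏ m ∈ Finset.range l, (Polynomial.X - Polynomial.C (qv ^ (j + ((m : ℤ) + 1)))))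
      = ((-1) ^ n * qv ^ (j * n - (n : ℤ) * (n + 1) / 2) * qP n) * (qv ^ (j * l) * qP l) := by
    rw [← aux_tri, ← aux_up]
    simp [Polynomial.eval_mul, Polynomial.eval_prod]
  have hne : ((-1) ^ n * qv ^ (j * n - (n : ℤ) * (n + 1) / 2) * qP n) * (qv ^ (j * l) * qP l) ≠ 0 :=
    mul_ne_zero (mul_ne_zero (mul_ne_zero (pow_ne_zero _ (by norm_num)) (zpow_ne_zero _ qv_ne))
      (qP_ne n)) (mul_ne_zero (zpow_ne_zero _ qv_ne) (qP_ne l))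
  have hmain := aux_eval (-Polynomial.X ^ k) _ (qv ^ j) (hev ▸ hne)
    ((xV - RatFunc.C (qv ^ j)) * σtR k) (by
      have hs : ∏ i ∈ Finset.range (k + k + 1), (xV - RatFunc.C (qv ^ (0 - (k : ℤ) + i)))
          = ∏ i ∈ Finset.range (n + l + 1), (xV - RatFunc.C (qv ^ (j - (n : ℤ) + i))) := by
        have c1 : k + k + 1 = n + l + 1 := by omega
        have c2 : (0 : ℤ) - k = j - n := by omega
        rw [c1, c2]
      rw [aux_sigma, hs, ← aux_prod (fun i : ℤ => xV - RatFunc.C (qv ^ i)) j n l]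
      have n0 := aux_lin_ne (qv ^ j)
      simp only [map_mul, map_prod, map_sub, map_neg, map_pow, RatFunc.algebraMap_X,
        RatFunc.algebraMap_C]
      change _ = -xV ^ k / ((∏ m ∈ Finset.range n, (xV - RatFunc.C (qv ^ (j - ((m : ℤ) + 1))))) *
        ∏ m ∈ Finset.range l, (xV - RatFunc.C (qv ^ (j + ((m : ℤ) + 1)))))
      have n1 : ∏ m ∈ Finset.range n, (xV - RatFunc.C (qv ^ (j - ((m : ℤ) + 1)))) ≠ 0 :=
        Finset.prod_ne_zero_iff.2 fun i _ => aux_lin_ne _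
      have n2 : ∏ m ∈ Finset.range l, (xV - RatFunc.C (qv ^ (j + ((m : ℤ) + 1)))) ≠ 0 :=
        Finset.prod_ne_zero_iff.2 fun i _ => aux_lin_ne _
      field_simp)
  refine ⟨hmain.1, hmain.2.trans ?_⟩
  rw [hev, Rres, hn, hl, Int.toNat_natCast, Int.toNat_natCast, zpow_natCast, div_eq_iff hne]
  have hexp : j * (j + 1) / 2 + (k : ℤ) * ((k : ℤ) + 1) / 2
      + (j * n - (n : ℤ) * (n + 1) / 2) + j * l = j * k := by
    have p1 := Int.ediv_mul_cancel (Int.even_mul_succ_self j).two_dvd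
    have p2 := Int.ediv_mul_cancel (Int.even_mul_succ_self (k : ℤ)).two_dvd
    have p3 := Int.ediv_mul_cancel (Int.even_mul_succ_self (n : ℤ)).two_dvd
    generalize j * (j + 1) / 2 = t1 at *
    generalize (k : ℤ) * ((k : ℤ) + 1) / 2 = t2 at *
    generalize (n : ℤ) * (n + 1) / 2 = t3 at *
    rw [← hn] at p3 ⊢
    rw [← hl]
    have : 2 * (t1 + t2 + (j * (k + j) - t3) + j * (k - j)) = 2 * (j * k) := by
      linear_combination p1 + p2 - p3
    omega
  have hx : Polynomial.eval (qv ^ j) (-Polynomial.X ^ k) = -qv ^ (j * k) := by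
    simp [zpow_mul]
  rw [hx, ← hexp, zpow_add₀ qv_ne, zpow_add₀ qv_ne _ (j * n - (n : ℤ) * (n + 1) / 2)]
  have hs : ((-1 : Fq) ^ n) * (-1) ^ n = 1 := by rw [← mul_pow]; simp
  have q1 := mul_inv_cancel₀ (mul_ne_zero (qP_ne l) (qP_ne n))
  generalize (qP l * qP n)⁻¹ = w at *
  generalize qv ^ (j * (j + 1) / 2 + (k : ℤ) * ((k : ℤ) + 1) / 2) = u1
  generalize qv ^ (j * n - (n : ℤ) * (n + 1) / 2) = u2
  generalize qv ^ (j * l) = u3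
  generalize (-1 : Fq) ^ n = s at *
  linear_combination (u1 * u2 * u3) * hs * (qP l * qP n * w) + (u1 * u2 * u3) * q1
end
end
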